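/- arXiv:1405.6146 — 12 statements merged into one kernel-verified Lean document; each statement's English description precedes it below -/
import Mathlib

section
/- For every integer n ≥ 2 and every random vector v = (v_1, …, v_n) of nonnegative real random variables (with arbitrary correlation among coordinates), the bundle revenue satisfies BRev(v) ≤ 5·ln(n)·SRev(v), and moreover the partition revenue satisfies PRev(v) ≤ 5·ln(n)·SRev(v). -/
open MeasureTheory ProbabilityTheory ENNReal

/-- Monopoly revenue of a single item with value `X`: `sup_{p>0} p·Pr[X ≥ p]`. -/
noncomputable def rev1 {Ω : Type*} [MeasurableSpace Ω] (μ : Measure Ω) (X : Ω → ℝ) : ℝ≥0∞ :=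
  ⨆ (p : ℝ) (_ : 0 < p), ENNReal.ofReal p * μ {ω | p ≤ X ω}

/-- Revenue of selling the items separately. -/
noncomputable def srev {Ω : Type*} [MeasurableSpace Ω] (μ : Measure Ω) {n : ℕ}
    (v : Fin n → Ω → ℝ) : ℝ≥0∞ :=
  ∑ i, rev1 μ (v i)

/-- Revenue of selling the grand bundle. -/
noncomputable def brev {Ω : Type*} [MeasurableSpace Ω] (μ : Measure Ω) {n : ℕ}
    (v : Fin n → Ω → ℝ) : ℝ≥0∞ :=
  rev1 μ (fun ω => ∑ i, v i ω)

/-- Revenue of the best partition mechanism. -/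
noncomputable def prev {Ω : Type*} [MeasurableSpace Ω] (μ : Measure Ω) {n : ℕ}
    (v : Fin n → Ω → ℝ) : ℝ≥0∞ :=
  ⨆ P : Finpartition (Finset.univ : Finset (Fin n)),
    ∑ S ∈ P.parts, rev1 μ (fun ω => ∑ i ∈ S, v i ω)

/-- The defining bound of the monopoly revenue, as a bound on the tail of `X`. -/
lemma measure_le_rev1_mul {Ω : Type*} [MeasurableSpace Ω] (μ : Measure Ω) (X : Ω → ℝ) {t : ℝ}
    (ht : 0 < t) : μ {ω | t ≤ X ω} ≤ rev1 μ X * ENNReal.ofReal (1 / t) := by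
  have h : ENNReal.ofReal t * μ {ω | t ≤ X ω} ≤ rev1 μ X :=
    le_iSup₂ (f := fun (p : ℝ) (_ : 0 < p) => ENNReal.ofReal p * μ {ω | p ≤ X ω}) t ht
  calc μ {ω | t ≤ X ω}
      = ENNReal.ofReal t * μ {ω | t ≤ X ω} * ENNReal.ofReal (1 / t) := by
        rw [mul_right_comm, ← ENNReal.ofReal_mul ht.le, mul_one_div_cancel ht.ne',
          ENNReal.ofReal_one, one_mul]
    _ ≤ _ := by gcongr

lemma lintegral_Ioc_ofReal_one_div_add {c p : ℝ} (hc : 0 < c) (hcp : c ≤ p) :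
    ∫⁻ t in Set.Ioc 0 (p - c), ENNReal.ofReal (1 / (t + c)) = ENNReal.ofReal (Real.log (p / c)) := by
  have hcont : ContinuousOn (fun t : ℝ => 1 / (t + c)) (Set.uIcc 0 (p - c)) := by
    rw [Set.uIcc_of_le (by linarith)]
    exact continuousOn_const.div (by fun_prop) fun t ht => by linarith [ht.1]
  rw [← ofReal_integral_eq_lintegral_ofReal]
  · rw [← intervalIntegral.integral_of_le (by linarith),
      intervalIntegral.integral_comp_add_right (fun t : ℝ => 1 / t), zero_add, sub_add_cancel,
      integral_one_div_of_pos hc (hc.trans_le hcp)]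
  · exact (intervalIntegrable_iff_integrableOn_Ioc_of_le (by linarith)).1 hcont.intervalIntegrable
  · filter_upwards [ae_restrict_mem measurableSet_Ioc] with t ht
    have := ht.1
    simp only [Pi.zero_apply]
    positivity

/-- The expectation of `X` truncated to the window `[c, p]` is at most `log (p / c)` times the
monopoly revenue of `X`. -/
lemma lintegral_truncation_le {Ω : Type*} [MeasurableSpace Ω] (μ : Measure Ω) {X : Ω → ℝ}
    (hX : Measurable X) {c p : ℝ} (hc : 0 < c) (hcp : c ≤ p) :
    ∫⁻ ω, ENNReal.ofReal (max 0 (min (X ω) p - c)) ∂μ ≤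
      rev1 μ X * ENNReal.ofReal (Real.log (p / c)) := by
  rw [lintegral_eq_lintegral_meas_le μ (f := fun ω => max 0 (min (X ω) p - c))
    (.of_forall fun ω => le_max_left _ _) (by fun_prop), ← lintegral_Ioc_ofReal_one_div_add hc hcp,
    ← lintegral_const_mul _ (by fun_prop), ← lintegral_indicator measurableSet_Ioi,
    ← lintegral_indicator measurableSet_Ioc]
  refine lintegral_mono fun t => ?_
  by_cases ht : 0 < t
  · rw [Set.indicator_of_mem (Set.mem_Ioi.2 ht)]
    by_cases htp : t ≤ p - c
    · rw [Set.indicator_of_mem (Set.mem_Ioc.2 ⟨ht, htp⟩)]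
      refine le_trans (measure_mono fun ω hω => ?_) (measure_le_rev1_mul μ X (by linarith))
      have h := (le_max_iff.1 (Set.mem_ofPred.1 hω)).resolve_left (not_le.2 ht)
      exact (le_sub_iff_add_le.1 h).trans (min_le_left _ _)
    · have : {ω | t ≤ max 0 (min (X ω) p - c)} = ∅ := by
        refine Set.eq_empty_of_forall_notMem fun ω hω => htp ?_
        have h := (le_max_iff.1 (Set.mem_ofPred.1 hω)).resolve_left (not_le.2 ht)
        linarith [min_le_right (X ω) p]
      rw [this, measure_empty]
      exact zero_le
  · rw [Set.indicator_of_notMem (by simpa using ht)]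
    exact zero_le

/-- If nonnegative numbers sum to at least `p`, truncating each of them to the window
`[p / (2n), p]` keeps at least half of `p`. -/
lemma half_le_sum_truncation {ι : Type*} {S : Finset ι} {n : ℕ} (hn : 1 ≤ n) (hS : S.card ≤ n)
    {x : ι → ℝ} {p : ℝ} (hp : 0 < p) (hx : p ≤ ∑ i ∈ S, x i) :
    p / 2 ≤ ∑ i ∈ S, max 0 (min (x i) p - p / (2 * n)) := by
  have hn' : (1 : ℝ) ≤ n := by exact_mod_cast hn
  by_cases h : ∃ i ∈ S, p ≤ x i
  · obtain ⟨i, hi, hpi⟩ := h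
    refine le_trans ?_ (Finset.single_le_sum
      (f := fun i => max 0 (min (x i) p - p / (2 * n))) (fun j _ => le_max_left _ _) hi)
    refine le_trans ?_ (le_max_right _ _)
    rw [min_eq_right hpi]
    have : p / (2 * n) ≤ p / 2 := by gcongr; linarith
    linarith
  · push Not at h
    have hsum : ∑ i ∈ S, (x i - p / (2 * n)) ≤
        ∑ i ∈ S, max 0 (min (x i) p - p / (2 * n)) := by
      refine Finset.sum_le_sum fun i hi => ?_
      rw [min_eq_left (h i hi).le]
      exact le_max_right _ _
    rw [Finset.sum_sub_distrib, Finset.sum_const, nsmul_eq_mul] at hsum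
    have hcard : (S.card : ℝ) * (p / (2 * n)) ≤ n * (p / (2 * n)) := by gcongr
    have : (n : ℝ) * (p / (2 * n)) = p / 2 := by field_simp
    linarith

/-- Bundling at most `n` arbitrarily correlated items gains at most a factor `2 * log (2 * n)`
over selling them separately. -/
lemma rev1_sum_le {Ω ι : Type*} [MeasurableSpace Ω] (μ : Measure Ω) {v : ι → Ω → ℝ}
    (hmeas : ∀ i, Measurable (v i)) {S : Finset ι} {n : ℕ} (hn : 1 ≤ n) (hS : S.card ≤ n) :
    rev1 μ (fun ω => ∑ i ∈ S, v i ω) ≤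
      ENNReal.ofReal (2 * Real.log (2 * n)) * ∑ i ∈ S, rev1 μ (v i) := by
  have hn' : (1 : ℝ) ≤ n := by exact_mod_cast hn
  refine iSup₂_le fun p hp => ?_
  have hc : 0 < p / (2 * n) := by positivity
  have hcp : p / (2 * n) ≤ p := div_le_self hp.le (by linarith)
  have hlog : p / (p / (2 * n)) = 2 * n := by field_simp
  have hmarkov : ENNReal.ofReal (p / 2) * μ {ω | p ≤ ∑ i ∈ S, v i ω} ≤
      ∑ i ∈ S, rev1 μ (v i) * ENNReal.ofReal (Real.log (2 * n)) := by
    calc _ ≤ ENNReal.ofReal (p / 2) * μ {ω | ENNReal.ofReal (p / 2) ≤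
            ∑ i ∈ S, ENNReal.ofReal (max 0 (min (v i ω) p - p / (2 * n)))} := by
          gcongr
          intro hω
          rw [← ENNReal.ofReal_sum_of_nonneg fun i _ => le_max_left _ _]
          exact ENNReal.ofReal_le_ofReal (half_le_sum_truncation hn hS hp hω)
      _ ≤ ∫⁻ ω, ∑ i ∈ S, ENNReal.ofReal (max 0 (min (v i ω) p - p / (2 * n))) ∂μ :=
          mul_meas_ge_le_lintegral (by fun_prop) _
      _ = ∑ i ∈ S, ∫⁻ ω, ENNReal.ofReal (max 0 (min (v i ω) p - p / (2 * n))) ∂μ :=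
          lintegral_finsetSum _ fun i _ => by fun_prop
      _ ≤ _ := by
          refine Finset.sum_le_sum fun i _ => ?_
          simpa only [hlog] using lintegral_truncation_le μ (hmeas i) hc hcp
  calc ENNReal.ofReal p * μ {ω | p ≤ ∑ i ∈ S, v i ω}
      = ENNReal.ofReal 2 * (ENNReal.ofReal (p / 2) * μ {ω | p ≤ ∑ i ∈ S, v i ω}) := by
        rw [← mul_assoc, ← ENNReal.ofReal_mul zero_le_two, mul_div_cancel₀ _ two_ne_zero]
    _ ≤ ENNReal.ofReal 2 * ∑ i ∈ S, rev1 μ (v i) * ENNReal.ofReal (Real.log (2 * n)) := by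
        gcongr
    _ = _ := by
        rw [← Finset.sum_mul, ENNReal.ofReal_mul zero_le_two]
        ring

/-- For any `n ≥ 2` and any (possibly correlated) nonnegative random vector `v`,
`BRev(v) ≤ 5·ln(n)·SRev(v)` and `PRev(v) ≤ 5·ln(n)·SRev(v)`. -/
theorem brev_and_prev_le_log_srev {n : ℕ} (hn : 2 ≤ n)
    {Ω : Type*} [MeasurableSpace Ω] (μ : Measure Ω) [IsProbabilityMeasure μ]
    (v : Fin n → Ω → ℝ) (hmeas : ∀ i, Measurable (v i)) (hnn : ∀ i ω, 0 ≤ v i ω) :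
    brev μ v ≤ ENNReal.ofReal (5 * Real.log n) * srev μ v ∧
    prev μ v ≤ ENNReal.ofReal (5 * Real.log n) * srev μ v := by
  have hn' : (2 : ℝ) ≤ n := by exact_mod_cast hn
  have hlog : 2 * Real.log (2 * n) ≤ 5 * Real.log n := by
    rw [Real.log_mul two_ne_zero (by positivity)]
    linarith [Real.log_le_log two_pos hn', Real.log_pos (one_lt_two.trans_le hn')]
  have key (S : Finset (Fin n)) : rev1 μ (fun ω => ∑ i ∈ S, v i ω) ≤
      ENNReal.ofReal (5 * Real.log n) * ∑ i ∈ S, rev1 μ (v i) :=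
    (rev1_sum_le μ hmeas (one_le_two.trans hn) (by simpa using S.card_le_univ)).trans
      (mul_le_mul_left (ENNReal.ofReal_le_ofReal hlog) _)
  refine ⟨key Finset.univ, iSup_le fun P => ?_⟩
  refine (Finset.sum_le_sum fun S _ => key S).trans_eq ?_
  have hparts := Finset.sum_biUnion P.disjoint (f := fun i => rev1 μ (v i))
  rw [P.biUnion_parts] at hparts
  rw [← Finset.mul_sum, srev, hparts]
  rfl
end

section
/- There exist a constant c > 0 and a threshold N such that for every integer n ≥ N there exists a random vector v = (v_1, …, v_n) of nonnegative real random variables (with correlated coordinates) satisfying PRev(v) ≥ c·ln(n)·max{SRev(v), BRev(v)} with 0 < max{SRev(v), BRev(v)} < ∞. -/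
open MeasureTheory ProbabilityTheory ENNReal

/-- Any family of distinct nonempty fibres of a labelling of the items bounds the best partition
revenue from below. -/
lemma sum_rev1_fiber_le_prev {Ω α : Type*} [MeasurableSpace Ω] [DecidableEq α] (μ : Measure Ω)
    {n : ℕ} (v : Fin n → Ω → ℝ) (f : Fin n → α) (s : Finset α) (hs : s ⊆ Finset.univ.image f) :
    ∑ a ∈ s, rev1 μ (fun ω => ∑ i with f i = a, v i ω) ≤ prev μ v := by
  let fib : α → Finset (Fin n) := fun a => Finset.univ.filter (fun i => f i = a)
  have hinj : Set.InjOn fib (Finset.univ.image f : Finset α) := by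
    intro a ha b _ hab
    obtain ⟨i, -, rfl⟩ := Finset.mem_image.1 ha
    have : i ∈ fib b := hab ▸ by simp [fib]
    simpa [fib] using this
  let P : Finpartition (Finset.univ : Finset (Fin n)) :=
    { parts := (Finset.univ.image f).image fib
      supIndep := by
        rw [Finset.supIndep_iff_pairwiseDisjoint]
        intro S hS T hT hST
        obtain ⟨a, -, rfl⟩ := Finset.mem_image.1 hS
        obtain ⟨b, -, rfl⟩ := Finset.mem_image.1 hT
        refine Finset.disjoint_left.2 fun i hi hj => hST ?_
        simp only [id_eq, fib, Finset.mem_filter, Finset.mem_univ, true_and] at hi hj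
        rw [← hi, ← hj]
      sup_parts := by
        ext i
        simp [Finset.mem_sup, fib]
      bot_notMem := by
        simp only [Finset.bot_eq_empty, Finset.mem_image, not_exists, not_and]
        rintro _ ⟨i, -, rfl⟩ h
        exact Finset.notMem_empty i (h ▸ by simp [fib]) }
  calc ∑ a ∈ s, rev1 μ (fun ω => ∑ i ∈ fib a, v i ω)
      ≤ ∑ a ∈ Finset.univ.image f, rev1 μ (fun ω => ∑ i ∈ fib a, v i ω) :=
        Finset.sum_le_sum_of_subset hs
    _ = ∑ S ∈ P.parts, rev1 μ (fun ω => ∑ i ∈ S, v i ω) :=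
        (Finset.sum_image (f := fun S => rev1 μ (fun ω => ∑ i ∈ S, v i ω)) hinj).symm
    _ ≤ prev μ v :=
        le_iSup (fun P : Finpartition (Finset.univ : Finset (Fin n)) =>
          ∑ S ∈ P.parts, rev1 μ (fun ω => ∑ i ∈ S, v i ω)) P

lemma uniformOn_univ_setOf {Ω : Type*} [Fintype Ω] [Nonempty Ω] [MeasurableSpace Ω]
    [MeasurableSingletonClass Ω] (q : Ω → Prop) [DecidablePred q] :
    uniformOn (Set.univ : Set Ω) {ω | q ω} =
      ENNReal.ofReal ((Finset.univ.filter q).card / (Fintype.card Ω : ℝ)) := by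
  have h : {ω | q ω} = ((Finset.univ.filter q : Finset Ω) : Set Ω) := by ext; simp
  rw [uniformOn_univ, h, Measure.count_apply_finset,
    ENNReal.ofReal_div_of_pos (by exact_mod_cast Fintype.card_pos), ENNReal.ofReal_natCast,
    ENNReal.ofReal_natCast]

lemma rev1_uniformOn_le {Ω : Type*} [Fintype Ω] [Nonempty Ω] [MeasurableSpace Ω]
    [MeasurableSingletonClass Ω] {X : Ω → ℝ} {C : ℝ}
    (h : ∀ p, 0 < p → p * (Finset.univ.filter fun ω => p ≤ X ω).card ≤ C * Fintype.card Ω) :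
    rev1 (uniformOn Set.univ) X ≤ ENNReal.ofReal C := by
  refine iSup₂_le fun p hp => ?_
  rw [uniformOn_univ_setOf, ← ENNReal.ofReal_mul hp.le, ← mul_div_assoc]
  exact ENNReal.ofReal_le_ofReal
    ((div_le_iff₀ (by exact_mod_cast Fintype.card_pos)).2 (h p hp))

lemma le_rev1_uniformOn {Ω : Type*} [Fintype Ω] [Nonempty Ω] [MeasurableSpace Ω]
    [MeasurableSingletonClass Ω] {X : Ω → ℝ} {C p : ℝ} (hp : 0 < p)
    (h : C * Fintype.card Ω ≤ p * (Finset.univ.filter fun ω => p ≤ X ω).card) :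
    ENNReal.ofReal C ≤ rev1 (uniformOn Set.univ) X := by
  refine le_trans ?_ (le_iSup₂ (f := fun (p : ℝ) (_ : 0 < p) =>
    ENNReal.ofReal p * uniformOn Set.univ {ω | p ≤ X ω}) p hp)
  rw [uniformOn_univ_setOf, ← ENNReal.ofReal_mul hp.le, ← mul_div_assoc]
  exact ENNReal.ofReal_le_ofReal
    ((le_div_iff₀ (by exact_mod_cast Fintype.card_pos)).2 h)

lemma card_filter_succ_le (N : ℕ) {t : ℝ} (ht : 0 ≤ t) :
    ((Finset.univ.filter fun x : Fin N => ((x : ℕ) : ℝ) + 1 ≤ t).card : ℝ) ≤ t := by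
  have h : (Finset.univ.filter fun x : Fin N => ((x : ℕ) : ℝ) + 1 ≤ t).card ≤
      (Finset.range ⌊t⌋₊).card := by
    refine Finset.card_le_card_of_injOn (fun x => (x : ℕ)) (fun x hx => ?_)
      (fun x _ y _ h => Fin.ext h)
    have hx' : ((x : ℕ) : ℝ) + 1 ≤ t := by simpa using hx
    simpa using Nat.lt_of_succ_le (Nat.le_floor (by push_cast; exact hx'))
  rw [Finset.card_range] at h
  exact (Nat.cast_le.2 h).trans (Nat.floor_le ht)

lemma le_card_filter_succ_le {N d : ℕ} (hd : d ≤ N) :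
    d ≤ (Finset.univ.filter fun x : Fin N => ((x : ℕ) : ℝ) + 1 ≤ d).card := by
  have h : (Finset.univ.map (Fin.castLEEmb hd)).card ≤
      (Finset.univ.filter fun x : Fin N => ((x : ℕ) : ℝ) + 1 ≤ d).card := by
    refine Finset.card_le_card fun x hx => ?_
    obtain ⟨y, -, rfl⟩ := Finset.mem_map.1 hx
    have : (y : ℕ) + 1 ≤ d := y.2
    simpa using (by exact_mod_cast this : ((y : ℕ) : ℝ) + 1 ≤ d)
  simpa using h

lemma sum_two_pow_le_two_mul (m : ℕ) {A : ℝ} (hA : 0 ≤ A) :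
    ∑ b ∈ Finset.range m, (if (2 : ℝ) ^ b ≤ A then (2 : ℝ) ^ b else 0) ≤ 2 * A := by
  induction m with
  | zero => simpa using hA
  | succ m ih =>
    by_cases h : (2 : ℝ) ^ m ≤ A
    · calc _ ≤ ∑ b ∈ Finset.range (m + 1), (2 : ℝ) ^ b :=
            Finset.sum_le_sum fun b _ => by split_ifs <;> first | exact le_rfl | positivity
        _ ≤ 2 * A := by
            rw [geom_sum_eq (by norm_num), pow_succ]
            linarith
    · rw [Finset.sum_range_succ, if_neg h, add_zero]
      exact ih

/-- Block `b` is active on the lowest `2 ^ (m - b)` of the `2 ^ m` levels; when active, its items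
receive the values `2 ^ b / 1, …, 2 ^ b / k` in a uniformly random cyclic order. -/
noncomputable def cyclicValue (m k : ℕ) [NeZero k] (q : Fin m × Fin k) (ω : Fin (2 ^ m) × Fin k) :
    ℝ :=
  if ((ω.1 : ℕ) : ℝ) + 1 ≤ (2 ^ (m - q.1) : ℕ) then
    2 ^ (q.1 : ℕ) / (((ω.2 + q.2 : Fin k) : ℕ) + 1 : ℝ)
  else 0

lemma cyclicValue_nonneg (m k : ℕ) [NeZero k] (q : Fin m × Fin k) (ω : Fin (2 ^ m) × Fin k) :
    0 ≤ cyclicValue m k q ω := by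
  unfold cyclicValue
  split_ifs <;> positivity

lemma sum_cyclicValue_block (m k : ℕ) [NeZero k] (b : Fin m) (ω : Fin (2 ^ m) × Fin k) :
    ∑ j, cyclicValue m k (b, j) ω =
      if ((ω.1 : ℕ) : ℝ) + 1 ≤ (2 ^ (m - b) : ℕ) then 2 ^ (b : ℕ) * (harmonic k : ℝ) else 0 := by
  unfold cyclicValue
  split_ifs with h
  · refine (Equiv.sum_comp (Equiv.addLeft ω.2)
      (fun j : Fin k => (2 : ℝ) ^ (b : ℕ) / ((j : ℕ) + 1 : ℝ))).trans ?_
    rw [Fin.sum_univ_eq_sum_range (fun j => (2 : ℝ) ^ (b : ℕ) / (j + 1 : ℝ)), harmonic]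
    push_cast
    rw [Finset.mul_sum]
    rfl
  · simp

lemma two_pow_sub_eq_div {m b : ℕ} (h : b ≤ m) :
    ((2 ^ (m - b) : ℕ) : ℝ) = 2 ^ m / 2 ^ b := by
  push_cast
  rw [pow_sub₀ _ two_ne_zero h, div_eq_mul_inv]

lemma rev1_cyclicValue_le (m k : ℕ) [NeZero k] [MeasurableSpace (Fin (2 ^ m) × Fin k)]
    [MeasurableSingletonClass (Fin (2 ^ m) × Fin k)] (q : Fin m × Fin k) :
    rev1 (uniformOn Set.univ) (cyclicValue m k q) ≤ ENNReal.ofReal (1 / k) := by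
  refine rev1_uniformOn_le fun p hp => ?_
  have hk : (k : ℝ) ≠ 0 := NeZero.ne _
  let A := Finset.univ.filter fun x : Fin (2 ^ m) => ((x : ℕ) : ℝ) + 1 ≤ (2 ^ (m - q.1) : ℕ)
  let B := Finset.univ.filter fun s : Fin k => ((s : ℕ) : ℝ) + 1 ≤ 2 ^ (q.1 : ℕ) / p
  have hcard : (Finset.univ.filter fun ω => p ≤ cyclicValue m k q ω).card ≤ (A ×ˢ B).card := by
    refine Finset.card_le_card_of_injOn (fun ω => (ω.1, ω.2 + q.2)) (fun ω hω => ?_) ?_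
    · have hω' : p ≤ cyclicValue m k q ω := by simpa using hω
      unfold cyclicValue at hω'
      split_ifs at hω' with h
      · rw [le_div_comm₀ hp (by positivity)] at hω'
        simp only [Finset.coe_product, Set.mem_prod, Finset.mem_coe, A, B, Finset.mem_filter,
          Finset.mem_univ, true_and]
        exact ⟨h, hω'⟩
      · linarith
    · rintro ⟨x, s⟩ _ ⟨y, t⟩ _ h
      simpa using h
  rw [Finset.card_product] at hcard
  have hA : (A.card : ℝ) ≤ 2 ^ m / 2 ^ (q.1 : ℕ) :=
    (card_filter_succ_le _ (by positivity)).trans_eq (two_pow_sub_eq_div q.1.2.le)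
  have hB : (B.card : ℝ) ≤ 2 ^ (q.1 : ℕ) / p := card_filter_succ_le _ (by positivity)
  calc p * ((Finset.univ.filter fun ω => p ≤ cyclicValue m k q ω).card : ℝ)
      ≤ p * (A.card * B.card) := by gcongr; exact_mod_cast hcard
    _ ≤ p * (2 ^ m / 2 ^ (q.1 : ℕ) * (2 ^ (q.1 : ℕ) / p)) := by gcongr
    _ = 1 / k * Fintype.card (Fin (2 ^ m) × Fin k) := by
        simp only [Fintype.card_prod, Fintype.card_fin]
        push_cast
        field_simp

lemma harmonic_cast_pos {k : ℕ} (hk : k ≠ 0) : (0 : ℝ) < harmonic k := by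
  exact_mod_cast harmonic_pos hk

lemma le_rev1_block (m k : ℕ) [NeZero k] [MeasurableSpace (Fin (2 ^ m) × Fin k)]
    [MeasurableSingletonClass (Fin (2 ^ m) × Fin k)] (b : Fin m)
    {X : Fin (2 ^ m) × Fin k → ℝ} (hX : ∀ ω, ∑ j, cyclicValue m k (b, j) ω ≤ X ω) :
    ENNReal.ofReal (harmonic k) ≤ rev1 (uniformOn Set.univ) X := by
  have hH := harmonic_cast_pos (NeZero.ne k)
  refine le_rev1_uniformOn (p := 2 ^ (b : ℕ) * harmonic k) (by positivity) ?_
  let A := Finset.univ.filter fun x : Fin (2 ^ m) => ((x : ℕ) : ℝ) + 1 ≤ (2 ^ (m - b) : ℕ)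
  have hA : 2 ^ (m - b) ≤ A.card :=
    le_card_filter_succ_le (Nat.pow_le_pow_right two_pos (Nat.sub_le _ _))
  have hcard : (A ×ˢ (Finset.univ : Finset (Fin k))).card ≤
      (Finset.univ.filter fun ω => 2 ^ (b : ℕ) * (harmonic k : ℝ) ≤ X ω).card := by
    refine Finset.card_le_card fun ω hω => ?_
    have hω' : ((ω.1 : ℕ) : ℝ) + 1 ≤ (2 ^ (m - b) : ℕ) := by
      simpa only [A, Finset.mem_product, Finset.mem_filter, Finset.mem_univ, true_and,
        and_true] using hω
    have h := hX ω
    rw [sum_cyclicValue_block, if_pos hω'] at h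
    simpa using h
  rw [Finset.card_product, Finset.card_univ, Fintype.card_fin] at hcard
  have hlow : (2 : ℝ) ^ m / 2 ^ (b : ℕ) * k ≤
      (Finset.univ.filter fun ω => 2 ^ (b : ℕ) * (harmonic k : ℝ) ≤ X ω).card := by
    rw [← two_pow_sub_eq_div b.2.le]
    exact_mod_cast (Nat.mul_le_mul_right k hA).trans hcard
  calc (harmonic k : ℝ) * Fintype.card (Fin (2 ^ m) × Fin k)
      = 2 ^ (b : ℕ) * harmonic k * (2 ^ m / 2 ^ (b : ℕ) * k) := by
        simp only [Fintype.card_prod, Fintype.card_fin]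
        push_cast
        field_simp
    _ ≤ _ := by gcongr

lemma rev1_total_le (m k : ℕ) [NeZero k] [MeasurableSpace (Fin (2 ^ m) × Fin k)]
    [MeasurableSingletonClass (Fin (2 ^ m) × Fin k)] :
    rev1 (uniformOn Set.univ) (fun ω => ∑ q, cyclicValue m k q ω) ≤
      ENNReal.ofReal (2 * harmonic k) := by
  have hH := harmonic_cast_pos (NeZero.ne k)
  have htot (ω : Fin (2 ^ m) × Fin k) :
      ∑ q, cyclicValue m k q ω ≤ 2 * (2 ^ m / ((ω.1 : ℕ) + 1)) * harmonic k := by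
    have hA : (0 : ℝ) ≤ 2 ^ m / ((ω.1 : ℕ) + 1) := by positivity
    calc ∑ q, cyclicValue m k q ω
        = ∑ b : Fin m, (if (2 : ℝ) ^ (b : ℕ) ≤ 2 ^ m / ((ω.1 : ℕ) + 1) then
            (2 : ℝ) ^ (b : ℕ) else 0) * harmonic k := by
          rw [Fintype.sum_prod_type]
          refine Finset.sum_congr rfl fun b _ => ?_
          rw [sum_cyclicValue_block, two_pow_sub_eq_div b.2.le, ite_mul, zero_mul]
          simp only [le_div_comm₀ (by positivity : (0 : ℝ) < (ω.1 : ℕ) + 1)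
            (by positivity : (0 : ℝ) < 2 ^ (b : ℕ))]
      _ ≤ _ := by
          rw [← Finset.sum_mul, Fin.sum_univ_eq_sum_range
            (fun b => if (2 : ℝ) ^ b ≤ 2 ^ m / ((ω.1 : ℕ) + 1) then (2 : ℝ) ^ b else 0)]
          gcongr
          exact sum_two_pow_le_two_mul m hA
  refine rev1_uniformOn_le fun p hp => ?_
  let B := Finset.univ.filter fun x : Fin (2 ^ m) =>
    ((x : ℕ) : ℝ) + 1 ≤ 2 * 2 ^ m * harmonic k / p
  have hcard : (Finset.univ.filter fun ω => p ≤ ∑ q, cyclicValue m k q ω).card ≤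
      (B ×ˢ (Finset.univ : Finset (Fin k))).card := by
    refine Finset.card_le_card fun ω hω => ?_
    have hω' : p ≤ ∑ q, cyclicValue m k q ω := by simpa using hω
    have h : p ≤ 2 * 2 ^ m * harmonic k / ((ω.1 : ℕ) + 1) :=
      (hω'.trans (htot ω)).trans_eq (by ring)
    rw [le_div_comm₀ hp (by positivity)] at h
    simpa only [B, Finset.mem_product, Finset.mem_filter, Finset.mem_univ, true_and,
      and_true] using h
  rw [Finset.card_product, Finset.card_univ, Fintype.card_fin] at hcard
  have hB : (B.card : ℝ) ≤ 2 * 2 ^ m * harmonic k / p := card_filter_succ_le _ (by positivity)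
  calc p * ((Finset.univ.filter fun ω => p ≤ ∑ q, cyclicValue m k q ω).card : ℝ)
      ≤ p * (B.card * k) := by gcongr; exact_mod_cast hcard
    _ ≤ p * (2 * 2 ^ m * harmonic k / p * k) := by gcongr
    _ = 2 * harmonic k * Fintype.card (Fin (2 ^ m) × Fin k) := by
        simp only [Fintype.card_prod, Fintype.card_fin]
        push_cast
        field_simp

lemma rev1_zero {Ω : Type*} [MeasurableSpace Ω] (μ : Measure Ω) :
    rev1 μ (fun _ => 0) = 0 := by
  simp only [rev1, ENNReal.iSup_eq_zero]
  intro p hp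
  simp [not_le.2 hp]

lemma natCast_le_two_mul_harmonic_two_pow (m : ℕ) : (m : ℝ) ≤ 2 * harmonic (2 ^ m) := by
  have h1 := log_add_one_le_harmonic (2 ^ m)
  have h2 : Real.log (2 ^ m) ≤ Real.log ((2 ^ m : ℕ) + 1) :=
    Real.log_le_log (by positivity) (by push_cast; linarith)
  push_cast at h1 h2
  rw [Real.log_pow] at h2
  have h3 := Real.log_two_gt_d9
  have h4 : (0 : ℝ) ≤ m := by positivity
  nlinarith

lemma log_le_four_mul_log_four {n : ℕ} (hn : 4 ≤ n) :
    Real.log n ≤ 4 * Nat.log 4 n := by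
  have hm : (1 : ℝ) ≤ Nat.log 4 n := by
    exact_mod_cast Nat.log_pos (by norm_num) hn
  have h1 : (n : ℝ) ≤ 4 ^ (Nat.log 4 n + 1) := by
    exact_mod_cast (Nat.lt_pow_succ_log_self (by norm_num) n).le
  have h2 := Real.log_le_log (by exact_mod_cast (by omega : 0 < n)) h1
  rw [Real.log_pow, show (4 : ℝ) = 2 ^ 2 by norm_num, Real.log_pow] at h2
  push_cast at h2
  have h3 := Real.log_two_lt_d9
  nlinarith

/-- There exist `c > 0` and a threshold `N` such that for every `n ≥ N` there is a
(correlated) nonnegative random vector `v` of length `n` with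
`PRev(v) ≥ c·ln(n)·max{SRev(v), BRev(v)}` and `0 < max{SRev(v), BRev(v)} < ∞`. -/
theorem exists_prev_log_gap :
    ∃ c : ℝ, 0 < c ∧ ∃ N : ℕ, ∀ n : ℕ, N ≤ n →
      ∃ (Ω : Type) (_ : MeasurableSpace Ω) (μ : Measure Ω) (_ : IsProbabilityMeasure μ)
        (v : Fin n → Ω → ℝ),
        (∀ i, Measurable (v i)) ∧ (∀ i ω, 0 ≤ v i ω) ∧
        0 < max (srev μ v) (brev μ v) ∧ max (srev μ v) (brev μ v) < ⊤ ∧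
        ENNReal.ofReal (c * Real.log n) * max (srev μ v) (brev μ v) ≤ prev μ v := by
  refine ⟨1 / 8, by norm_num, 4, fun n hn => ?_⟩
  obtain ⟨m, hm_def⟩ : ∃ m, m = Nat.log 4 n := ⟨_, rfl⟩
  have hm : 0 < m := hm_def ▸ Nat.log_pos (by norm_num) hn
  let k := 2 ^ m
  have hmk : m * k ≤ n := calc
    m * 2 ^ m ≤ 2 ^ m * 2 ^ m := Nat.mul_le_mul_right _ Nat.lt_two_pow_self.le
    _ = 4 ^ m := by rw [← mul_pow]; norm_num
    _ ≤ n := hm_def ▸ Nat.pow_log_le_self 4 (by omega)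
  have hk : NeZero k := ⟨by positivity⟩
  have hH := harmonic_cast_pos hk.ne
  let e : Fin n ≃ (Fin m × Fin k) ⊕ Fin (n - m * k) :=
    Fintype.equivOfCardEq (by simp; omega)
  let Ω := Fin (2 ^ m) × Fin k
  let _ : MeasurableSpace Ω := ⊤
  let μ : Measure Ω := uniformOn Set.univ
  let w : (Fin m × Fin k) ⊕ Fin (n - m * k) → Ω → ℝ := Sum.elim (cyclicValue m k) (fun _ _ => 0)
  let v : Fin n → Ω → ℝ := fun i => w (e i)
  let f : Fin n → Option (Fin m) := fun i => Sum.elim (fun q => some q.1) (fun _ => none) (e i)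
  have hsrev : srev μ v ≤ ENNReal.ofReal m := by
    have hk' : (k : ℝ) ≠ 0 := NeZero.ne _
    calc srev μ v = ∑ y, rev1 μ (w y) := Equiv.sum_comp e fun y => rev1 μ (w y)
      _ = ∑ q, rev1 μ (cyclicValue m k q) := by
          simp [Fintype.sum_sum_type, w, rev1_zero]
      _ ≤ ∑ _q : Fin m × Fin k, ENNReal.ofReal (1 / k) :=
          Finset.sum_le_sum fun q _ => rev1_cyclicValue_le m k q
      _ = ENNReal.ofReal m := by
          rw [← ENNReal.ofReal_sum_of_nonneg fun _ _ => by positivity]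
          congr 1
          simp only [Finset.sum_const, Finset.card_univ, Fintype.card_prod, Fintype.card_fin,
            nsmul_eq_mul, Nat.cast_mul]
          field_simp
  have hsum (ω : Ω) : ∑ i, v i ω = ∑ q, cyclicValue m k q ω := by
    rw [Equiv.sum_comp e fun y => w y ω]
    simp [Fintype.sum_sum_type, w]
  have hblock (b : Fin m) (ω : Ω) :
      ∑ i with f i = some b, v i ω = ∑ j, cyclicValue m k (b, j) ω := by
    rw [Finset.sum_filter, Equiv.sum_comp e fun y =>
      if Sum.elim (fun q => some q.1) (fun _ => none) y = some b then w y ω else 0]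
    simp only [Fintype.sum_sum_type, Fintype.sum_prod_type, w, Sum.elim_inl, Sum.elim_inr]
    rw [Finset.sum_comm]
    simp
  have hbrev : brev μ v ≤ ENNReal.ofReal (2 * harmonic k) := by
    simpa only [brev, hsum] using rev1_total_le m k
  have hbrev_pos : ENNReal.ofReal (harmonic k) ≤ brev μ v := by
    refine le_rev1_block m k ⟨0, hm⟩ fun ω => ?_
    rw [hsum, Fintype.sum_prod_type]
    exact Finset.single_le_sum (f := fun b => ∑ j, cyclicValue m k (b, j) ω)
      (fun b _ => Finset.sum_nonneg fun j _ => cyclicValue_nonneg _ _ _ _) (Finset.mem_univ _)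
  have hmax : max (srev μ v) (brev μ v) ≤ ENNReal.ofReal (2 * harmonic k) :=
    max_le (hsrev.trans (ENNReal.ofReal_le_ofReal (natCast_le_two_mul_harmonic_two_pow m))) hbrev
  have hprev : ENNReal.ofReal (m * harmonic k) ≤ prev μ v := by
    refine le_trans ?_ (sum_rev1_fiber_le_prev μ v f (Finset.univ.map .some) fun a ha => ?_)
    · rw [Finset.sum_map]
      calc ENNReal.ofReal (m * harmonic k)
          = ∑ _b : Fin m, ENNReal.ofReal (harmonic k) := by
            rw [← ENNReal.ofReal_sum_of_nonneg fun _ _ => hH.le]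
            simp
        _ ≤ _ := Finset.sum_le_sum fun b _ => le_rev1_block m k b fun ω => (hblock b ω).ge
    · obtain ⟨b, -, rfl⟩ := Finset.mem_map.1 ha
      exact Finset.mem_image.2 ⟨e.symm (Sum.inl (b, 0)), Finset.mem_univ _, by simp [f]⟩
  refine ⟨Ω, inferInstance, μ, inferInstance, v, fun i => measurable_from_top, fun i ω => ?_,
    ?_, hmax.trans_lt ENNReal.ofReal_lt_top, ?_⟩
  · change 0 ≤ w (e i) ω
    rcases e i with q | r
    · exact cyclicValue_nonneg m k q ω
    · exact le_rfl
  · exact ((ENNReal.ofReal_pos.2 hH).trans_le hbrev_pos).trans_le (le_max_right _ _)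
  · have hlog := log_le_four_mul_log_four hn
    rw [← hm_def] at hlog
    calc ENNReal.ofReal (1 / 8 * Real.log n) * max (srev μ v) (brev μ v)
        ≤ ENNReal.ofReal (m / 2) * ENNReal.ofReal (2 * harmonic k) := by
          gcongr
          linarith
      _ = ENNReal.ofReal (m * harmonic k) := by
          rw [← ENNReal.ofReal_mul (by positivity)]
          ring_nf
      _ ≤ prev μ v := hprev
end

section
/- Let v_1, …, v_n be nonnegative real random variables (not necessarily independent) and let r_1, …, r_n > 0 satisfy p·Pr[v_i ≥ p] ≤ r_i for all p > 0 and all i. Let c > 0 be such that c·n ≥ 1, and assume Pr[v_i ≤ c·n·r_i] > 0 for each i. Then ∑_{i=1}^n E[v_i ∣ v_i ≤ c·n·r_i] ≤ (1 + ln c + ln n)·∑_{i=1}^n r_i. -/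
open MeasureTheory ProbabilityTheory ENNReal

/-- If two events `A` and `B` cover the whole space, conditioning on `B` does not make `A` more
likely. -/
theorem cond_real_le_of_union_eq_univ {Ω : Type*} [MeasurableSpace Ω]
    (μ : Measure Ω) [IsProbabilityMeasure μ] {A B : Set Ω}
    (hB : MeasurableSet B) (hAB : A ∪ B = Set.univ) (hpos : 0 < μ B) :
    (μ[|B]).real A ≤ μ.real A := by
  have hBpos : 0 < μ.real B := ENNReal.toReal_pos hpos.ne' (measure_ne_top _ _)
  rw [measureReal_def, cond_apply hB, ENNReal.toReal_mul, ENNReal.toReal_inv, ← measureReal_def,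
    ← measureReal_def, inv_mul_le_iff₀ hBpos, Set.inter_comm]
  have h := measureReal_union_add_inter (μ := μ) (s := A) hB
  rw [hAB, probReal_univ] at h
  nlinarith [mul_nonneg (sub_nonneg.2 (measureReal_le_one (μ := μ) (s := A)))
    (sub_nonneg.2 (measureReal_le_one (μ := μ) (s := B)))]

/-- A nonnegative random variable bounded by `t` whose posted-price revenue is at most `r ≤ t`
has mean at most `r * (1 + log (t / r))`. -/
theorem integral_le_of_revenue_le {Ω : Type*} [MeasurableSpace Ω]
    (ν : Measure Ω) [IsProbabilityMeasure ν] {X : Ω → ℝ} (hX : Measurable X)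
    (hnn : ∀ ω, 0 ≤ X ω) {r t : ℝ} (hr : 0 < r) (hrt : r ≤ t) (hXt : ∀ᵐ ω ∂ν, X ω ≤ t)
    (hrev : ∀ p > (0 : ℝ), p * ν.real {ω | p ≤ X ω} ≤ r) :
    ∫ ω, X ω ∂ν ≤ r * (1 + Real.log (t / r)) := by
  have ht : 0 < t := hr.trans_le hrt
  have hint : Integrable X ν :=
    Integrable.of_bound hX.aestronglyMeasurable t <| by
      filter_upwards [hXt] with ω hω
      rwa [Real.norm_of_nonneg (hnn ω)]
  rw [hint.integral_eq_integral_Ioc_meas_le (Filter.Eventually.of_forall hnn) hXt,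
    ← intervalIntegral.integral_of_le ht.le]
  have hanti : Antitone fun p : ℝ => ν.real {ω | p ≤ X ω} := fun p q hpq =>
    measureReal_mono fun ω (hω : q ≤ X ω) => hpq.trans hω
  have hii (a b : ℝ) : IntervalIntegrable (fun p : ℝ => ν.real {ω | p ≤ X ω}) volume a b :=
    hanti.intervalIntegrable
  rw [← intervalIntegral.integral_add_adjacent_intervals (hii 0 r) (hii r t)]
  have hlow : ∫ p in (0 : ℝ)..r, ν.real {ω | p ≤ X ω} ≤ r := by
    calc ∫ p in (0 : ℝ)..r, ν.real {ω | p ≤ X ω} ≤ ∫ _ in (0 : ℝ)..r, (1 : ℝ) :=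
          intervalIntegral.integral_mono_on hr.le (hii 0 r) intervalIntegrable_const
            fun p _ => measureReal_le_one
      _ = r := by simp
  have hhigh : ∫ p in r..t, ν.real {ω | p ≤ X ω} ≤ r * Real.log (t / r) := by
    have hinv : IntervalIntegrable (fun p : ℝ => r * p⁻¹) volume r t :=
      (intervalIntegrable_inv_iff.2 (Or.inr (Set.notMem_uIcc_of_lt hr ht))).const_mul r
    calc ∫ p in r..t, ν.real {ω | p ≤ X ω} ≤ ∫ p in r..t, r * p⁻¹ := by
          refine intervalIntegral.integral_mono_on hrt (hii r t) hinv fun p hp => ?_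
          have hp0 : 0 < p := hr.trans_le hp.1
          rw [← div_eq_mul_inv, le_div_iff₀ hp0, mul_comm]
          exact hrev p hp0
      _ = r * Real.log (t / r) := by
          rw [intervalIntegral.integral_const_mul, integral_inv_of_pos hr ht]
  linarith

/-- For (possibly dependent) nonnegative values with per-item monopoly revenue at
most `r_i`, thresholds `c·n·r_i` with `c·n ≥ 1`, the total core welfare
`∑ᵢ E[vᵢ ∣ vᵢ ≤ c·n·rᵢ]` is at most `(1 + ln c + ln n)·∑ᵢ rᵢ`. -/
theorem core_welfare_le {n : ℕ} {Ω : Type*} [MeasurableSpace Ω]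
    (μ : Measure Ω) [IsProbabilityMeasure μ]
    (v : Fin n → Ω → ℝ) (hmeas : ∀ i, Measurable (v i)) (hnn : ∀ i ω, 0 ≤ v i ω)
    (r : Fin n → ℝ) (hr : ∀ i, 0 < r i)
    (hrev : ∀ i, ∀ p > (0:ℝ), p * (μ {ω | p ≤ v i ω}).toReal ≤ r i)
    (c : ℝ) (hc : 0 < c) (hcn : 1 ≤ c * n)
    (hq : ∀ i, 0 < μ {ω | v i ω ≤ c * n * r i}) :
    ∑ i, ∫ ω, v i ω ∂(μ[|{ω | v i ω ≤ c * n * r i}])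
      ≤ (1 + Real.log c + Real.log n) * ∑ i, r i := by
  have hn : (0 : ℝ) < n := by
    by_contra! h
    nlinarith
  rw [Finset.mul_sum]
  refine Finset.sum_le_sum fun i _ => ?_
  have hB : MeasurableSet {ω | v i ω ≤ c * n * r i} := measurableSet_le (hmeas i) measurable_const
  have : IsProbabilityMeasure (μ[|{ω | v i ω ≤ c * n * r i}]) :=
    cond_isProbabilityMeasure (hq i).ne'
  have hbound : ∀ᵐ ω ∂(μ[|{ω | v i ω ≤ c * n * r i}]), v i ω ≤ c * n * r i :=
    ae_cond_mem hB
  refine (integral_le_of_revenue_le _ (hmeas i) (hnn i) (hr i)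
    (le_mul_of_one_le_left (hr i).le hcn) hbound fun p hp => ?_).trans_eq ?_
  · rcases le_or_gt p (c * n * r i) with hpt | hpt
    · refine (mul_le_mul_of_nonneg_left ?_ hp.le).trans (hrev i p hp)
      refine cond_real_le_of_union_eq_univ μ hB (Set.eq_univ_of_forall fun ω => ?_) (hq i)
      exact (le_total p (v i ω)).imp id fun h => h.trans hpt
    · have hzero : (μ[|{ω | v i ω ≤ c * n * r i}]) {ω | p ≤ v i ω} = 0 := by
        rw [measure_eq_zero_iff_ae_notMem]
        filter_upwards [hbound] with ω hω
        exact fun h : p ≤ v i ω => (hω.trans_lt hpt).not_ge h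
      simp [measureReal_def, hzero, (hr i).le]
  · rw [mul_div_cancel_right₀ _ (hr i).ne', Real.log_mul hc.ne' hn.ne']
    ring
end

section
/- Let X be a nonnegative real random variable and r > 0 such that p·Pr[X ≥ p] ≤ r for every p > 0, and let t > 0 be a threshold with q := Pr[X ≤ t·r] > 0. Let Y be a random variable distributed as X conditioned on the event {X ≤ t·r}. Then p·Pr[Y ≥ p] ≤ r for every p > 0; that is, the monopoly revenue of the core distribution is also at most r. -/
open MeasureTheory ProbabilityTheory ENNReal

/-- If the monopoly revenue of a nonnegative value `X` is at most `r`, then the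
monopoly revenue of the core (the distribution of `X` conditioned on `{X ≤ t·r}`) is also at
most `r`: every posted price `p > 0` yields revenue `p·Pr[X ≥ p ∣ X ≤ t·r] ≤ r`. -/
theorem core_revenue_le {Ω : Type*} [MeasurableSpace Ω] (μ : Measure Ω) [IsProbabilityMeasure μ]
    (X : Ω → ℝ) (hX : Measurable X) (hnn : ∀ ω, 0 ≤ X ω)
    (r : ℝ) (hr : 0 < r) (hrev : ∀ p > (0:ℝ), p * (μ {ω | p ≤ X ω}).toReal ≤ r)
    (t : ℝ) (ht : 0 < t) (hq : 0 < μ {ω | X ω ≤ t * r}) :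
    ∀ p > (0:ℝ), p * ((μ[|{ω | X ω ≤ t * r}]) {ω | p ≤ X ω}).toReal ≤ r := by
  intro p hp
  have hS : MeasurableSet {ω | X ω ≤ t * r} := measurableSet_le hX measurable_const
  have := cond_isProbabilityMeasure (μ := μ) hq.ne'
  change p * (μ[|{ω | X ω ≤ t * r}]).real {ω | p ≤ X ω} ≤ r
  rcases le_or_gt p r with hpr | hpr
  · nlinarith [measureReal_le_one (μ := μ[|{ω | X ω ≤ t * r}]) (s := {ω | p ≤ X ω})]
  rcases le_or_gt p (t * r) with hpt | hpt
  · have hq' : 0 < μ.real {ω | X ω ≤ t * r} :=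
      ENNReal.toReal_pos hq.ne' (measure_ne_top _ _)
    have hrevp : p * μ.real {ω | p ≤ X ω} ≤ r := hrev p hp
    have hcompl := probReal_compl_eq_one_sub (μ := μ) hS
    have hsplit := measureReal_inter_add_sdiff (μ := μ) (s := {ω | p ≤ X ω}) hS
    have htail : {ω | p ≤ X ω} \ {ω | X ω ≤ t * r} = {ω | X ω ≤ t * r}ᶜ := by
      ext ω
      simp only [Set.mem_sdiff, Set.mem_ofPred_eq, Set.mem_compl_iff, not_le, and_iff_right_iff_imp]
      exact fun h => hpt.trans h.le
    rw [htail] at hsplit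
    rw [measureReal_def, cond_apply hS, ENNReal.toReal_mul, ENNReal.toReal_inv, ← measureReal_def,
      ← measureReal_def, Set.inter_comm, inv_mul_eq_div, mul_div_assoc', div_le_iff₀ hq']
    nlinarith [measureReal_nonneg (μ := μ) (s := {ω | X ω ≤ t * r}ᶜ)]
  · have hempty : {ω | X ω ≤ t * r} ∩ {ω | p ≤ X ω} = ∅ := by
      ext ω
      simp only [Set.mem_inter_iff, Set.mem_ofPred_eq, Set.mem_empty_iff_false, iff_false, not_and,
        not_le]
      exact fun h => h.trans_lt hpt
    rw [measureReal_def, cond_apply hS, hempty]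
    simpa using hr.le
end

section
/- Let c > 0, t ≥ 1, and let X be a real random variable with 0 ≤ X ≤ t·c almost surely such that p·Pr[X ≥ p] ≤ c for every p > 0. Then E[X²] ≤ (2t − 1)·c², and in particular Var(X) ≤ (2t − 1)·c². -/
open MeasureTheory ProbabilityTheory ENNReal

/-- If `0 ≤ X ≤ t·c` almost surely and the monopoly revenue of `X` is at most `c`,
then `E[X²] ≤ (2t − 1)·c²`, and in particular `Var(X) ≤ (2t − 1)·c²`. -/
theorem second_moment_le {Ω : Type*} [MeasurableSpace Ω] (μ : Measure Ω) [IsProbabilityMeasure μ]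
    (X : Ω → ℝ) (hX : Measurable X) (c t : ℝ) (hc : 0 < c) (ht : 1 ≤ t)
    (hbdd : ∀ᵐ ω ∂μ, 0 ≤ X ω ∧ X ω ≤ t * c)
    (hrev : ∀ p > (0:ℝ), p * (μ {ω | p ≤ X ω}).toReal ≤ c) :
    (∫ ω, X ω ^ 2 ∂μ) ≤ (2 * t - 1) * c ^ 2 ∧ variance X μ ≤ (2 * t - 1) * c ^ 2 := by
  have hmoment : (∫ ω, X ω ^ 2 ∂μ) ≤ (2 * t - 1) * c ^ 2 := by
    have hctc : c ≤ t * c := by nlinarith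
    have hprim : ∀ x : ℝ, ∫ p in (0 : ℝ)..x, 2 * p = x ^ 2 := by
      intro x
      rw [intervalIntegral.integral_const_mul, integral_id]
      ring
    have hlayer : ∫⁻ ω, ENNReal.ofReal (X ω ^ 2) ∂μ =
        ∫⁻ p in Set.Ioi 0, μ {ω | p ≤ X ω} * ENNReal.ofReal (2 * p) := by
      rw [← lintegral_comp_eq_lintegral_meas_le_mul μ (hbdd.mono fun _ h => h.1) hX.aemeasurable
        (fun x _ => (by fun_prop : Continuous fun p : ℝ => 2 * p).intervalIntegrable 0 x)]
      · simp only [hprim]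
      · filter_upwards [ae_restrict_mem measurableSet_Ioi] with p hp
        exact mul_nonneg zero_le_two (le_of_lt hp)
    have hlow : ∫⁻ p in Set.Ioc 0 c, μ {ω | p ≤ X ω} * ENNReal.ofReal (2 * p) ≤
        ENNReal.ofReal (c ^ 2) := by
      calc ∫⁻ p in Set.Ioc 0 c, μ {ω | p ≤ X ω} * ENNReal.ofReal (2 * p)
          ≤ ∫⁻ p in Set.Ioc 0 c, ENNReal.ofReal (2 * p) :=
            lintegral_mono fun p => mul_le_of_le_one_left' prob_le_one
        _ = ENNReal.ofReal (c ^ 2) := by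
            rw [← hprim c, intervalIntegral.integral_of_le hc.le,
              ofReal_integral_eq_lintegral_ofReal]
            · exact ((by fun_prop : Continuous fun p : ℝ => 2 * p).intervalIntegrable 0 c).1
            · filter_upwards [ae_restrict_mem measurableSet_Ioc] with p hp
              exact mul_nonneg zero_le_two hp.1.le
    have hmid : ∫⁻ p in Set.Ioc c (t * c), μ {ω | p ≤ X ω} * ENNReal.ofReal (2 * p) ≤
        ENNReal.ofReal (2 * c * (t * c - c)) := by
      calc ∫⁻ p in Set.Ioc c (t * c), μ {ω | p ≤ X ω} * ENNReal.ofReal (2 * p)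
          ≤ ∫⁻ _ in Set.Ioc c (t * c), ENNReal.ofReal (2 * c) := by
            refine setLIntegral_mono measurable_const fun p hp => ?_
            rw [← ofReal_toReal (measure_ne_top μ {ω | p ≤ X ω}), ← ofReal_mul toReal_nonneg]
            exact ofReal_le_ofReal (by linarith [hrev p (hc.trans hp.1)])
        _ = ENNReal.ofReal (2 * c * (t * c - c)) := by
            rw [setLIntegral_const, Real.volume_Ioc, ← ofReal_mul (by positivity)]
    have hhigh : ∫⁻ p in Set.Ioi (t * c), μ {ω | p ≤ X ω} * ENNReal.ofReal (2 * p) = 0 := by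
      refine setLIntegral_eq_zero measurableSet_Ioi fun p hp => ?_
      have hnull : μ {ω | p ≤ X ω} = 0 := by
        rw [measure_eq_zero_iff_ae_notMem]
        filter_upwards [hbdd] with ω hω using not_le.mpr (hω.2.trans_lt hp)
      simp [hnull]
    rw [integral_eq_lintegral_of_nonneg_ae (.of_forall fun _ => sq_nonneg _)
      (hX.pow_const 2).aestronglyMeasurable]
    refine toReal_le_of_le_ofReal (mul_nonneg (by linarith) (sq_nonneg c)) ?_
    rw [hlayer, ← Set.Ioc_union_Ioi_eq_Ioi (hc.le.trans hctc),
      ← Set.Ioc_union_Ioc_eq_Ioc hc.le hctc]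
    calc _ ≤ ENNReal.ofReal (c ^ 2) + ENNReal.ofReal (2 * c * (t * c - c)) + 0 :=
          (lintegral_union_le _ _ _).trans
            (add_le_add ((lintegral_union_le _ _ _).trans (add_le_add hlow hmid)) hhigh.le)
      _ = ENNReal.ofReal ((2 * t - 1) * c ^ 2) := by
          rw [add_zero, ← ofReal_add (sq_nonneg c)
            (mul_nonneg (by positivity) (sub_nonneg.mpr hctc))]
          congr 1
          ring
  exact ⟨hmoment, (variance_le_expectation_sq hX.aestronglyMeasurable).trans hmoment⟩
end

section
/- Let X be a nonnegative real random variable and r > 0 such that p·Pr[X ≥ p] ≤ r for every p > 0, let t ≥ 1, and suppose Pr[X ≤ t·r] > 0. Let Y be distributed as X conditioned on the event {X ≤ t·r}. Then Var(Y) ≤ 2·t·r². -/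
open MeasureTheory ProbabilityTheory ENNReal

/-- Conditioning on `A` does not increase the probability of an event containing `Aᶜ`. -/
lemma cond_real_le_of_compl_subset {Ω : Type*} [MeasurableSpace Ω] (μ : Measure Ω)
    [IsProbabilityMeasure μ] {A B : Set Ω} (hA : MeasurableSet A) (h : Aᶜ ⊆ B) :
    (μ[|A]).real B ≤ μ.real B := by
  rw [Measure.real, cond_apply hA, ENNReal.toReal_mul, ENNReal.toReal_inv]
  change (μ.real A)⁻¹ * μ.real (A ∩ B) ≤ μ.real B
  have hB : μ.real (A ∩ B) + μ.real Aᶜ = μ.real B := by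
    rw [← measureReal_inter_add_sdiff (μ := μ) (s := B) hA, Set.inter_comm, Set.sdiff_eq,
      Set.inter_eq_self_of_subset_right h]
  rw [probReal_compl_eq_one_sub hA] at hB
  have hAB : μ.real (A ∩ B) ≤ μ.real A := measureReal_mono Set.inter_subset_left
  rcases (measureReal_nonneg (μ := μ) (s := A)).eq_or_lt with h0 | h0
  · simp [← h0]
  · rw [inv_mul_le_iff₀ h0]
    have h1 : μ.real A ≤ 1 := measureReal_le_one
    nlinarith [mul_nonneg (sub_nonneg.2 h1) (sub_nonneg.2 hAB)]

/-- The core inherits the revenue bound, and vanishes above the threshold. -/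
lemma core_tail_mul_le {Ω : Type*} [MeasurableSpace Ω] (μ : Measure Ω) [IsProbabilityMeasure μ]
    {X : Ω → ℝ} (hX : Measurable X) {r : ℝ}
    (hrev : ∀ p > (0:ℝ), p * (μ {ω | p ≤ X ω}).toReal ≤ r) (s : ℝ) {p : ℝ} (hp : 0 < p) :
    (μ[|{ω | X ω ≤ s}]) {ω | p ≤ X ω} * ENNReal.ofReal (2 * p) ≤
      (Set.Iic s).indicator (fun _ ↦ ENNReal.ofReal (2 * r)) p := by
  have hA : MeasurableSet {ω | X ω ≤ s} := measurableSet_le hX measurable_const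
  by_cases hps : p ≤ s
  · rw [Set.indicator_of_mem (Set.mem_Iic.2 hps),
      ← ENNReal.ofReal_toReal (measure_ne_top _ {ω | p ≤ X ω}),
      ← ENNReal.ofReal_mul ENNReal.toReal_nonneg]
    have h := cond_real_le_of_compl_subset μ (B := {ω | p ≤ X ω}) hA (fun ω hω ↦ by
      simp only [Set.mem_compl_iff, Set.mem_ofPred_eq, not_le] at hω ⊢
      linarith)
    refine ENNReal.ofReal_le_ofReal ?_
    have h' := mul_le_mul_of_nonneg_left h hp.le
    have := hrev p hp
    simp only [Measure.real] at h'
    linarith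
  · have : {ω | X ω ≤ s} ∩ {ω | p ≤ X ω} = ∅ := by
      ext ω
      simp only [Set.mem_inter_iff, Set.mem_ofPred_eq, Set.mem_empty_iff_false, iff_false]
      rintro ⟨h₁, h₂⟩
      exact hps (h₂.trans h₁)
    rw [cond_apply hA, this]
    simp

/-- If the monopoly revenue of a nonnegative value `X` is at most `r` and `t ≥ 1`,
then the variance of the core (the distribution of `X` conditioned on `{X ≤ t·r}`) is at most
`2·t·r²`. -/
theorem core_variance_le {Ω : Type*} [MeasurableSpace Ω] (μ : Measure Ω) [IsProbabilityMeasure μ]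
    (X : Ω → ℝ) (hX : Measurable X) (hnn : ∀ ω, 0 ≤ X ω)
    (r : ℝ) (hr : 0 < r) (hrev : ∀ p > (0:ℝ), p * (μ {ω | p ≤ X ω}).toReal ≤ r)
    (t : ℝ) (ht : 1 ≤ t) (hq : 0 < μ {ω | X ω ≤ t * r}) :
    variance X (μ[|{ω | X ω ≤ t * r}]) ≤ 2 * t * r ^ 2 := by
  have : IsProbabilityMeasure (μ[|{ω | X ω ≤ t * r}]) := cond_isProbabilityMeasure hq.ne'
  refine (variance_le_expectation_sq hX.aestronglyMeasurable).trans ?_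
  simp only [Pi.pow_apply]
  rw [integral_eq_lintegral_of_nonneg_ae (.of_forall fun ω ↦ sq_nonneg (X ω))
    (hX.pow_const 2).aestronglyMeasurable]
  refine ENNReal.toReal_le_of_le_ofReal (by positivity) ?_
  have key := lintegral_comp_eq_lintegral_meas_le_mul (μ[|{ω | X ω ≤ t * r}]) (f := X)
    (g := fun p ↦ 2 * p) (.of_forall hnn) hX.aemeasurable
    (fun _ _ ↦ (by fun_prop : Continuous fun p : ℝ ↦ 2 * p).intervalIntegrable _ _)
    ((ae_restrict_iff' measurableSet_Ioi).2 (.of_forall fun p (hp : 0 < p) ↦ by positivity))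
  have hint (x : ℝ) : ∫ p in (0:ℝ)..x, 2 * p = x ^ 2 := by
    rw [intervalIntegral.integral_const_mul, integral_id]
    ring
  simp only [hint] at key
  rw [key]
  calc _ ≤ ∫⁻ p in Set.Ioi (0:ℝ),
        (Set.Iic (t * r)).indicator (fun _ ↦ ENNReal.ofReal (2 * r)) p :=
        setLIntegral_mono' measurableSet_Ioi fun p hp ↦ core_tail_mul_le μ hX hrev _ hp
    _ = ENNReal.ofReal (2 * t * r ^ 2) := by
        rw [lintegral_indicator_const measurableSet_Iic, Measure.restrict_apply measurableSet_Iic,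
          Set.inter_comm, Set.Ioi_inter_Iic, Real.volume_Ioc, ← ENNReal.ofReal_mul (by positivity)]
        congr 1
        ring
end

section
/- Let X be a nonnegative real random variable and r > 0 such that p·Pr[X ≥ p] ≤ r for every p > 0, and let t ≥ 1. Then ∫_0^{t·r} Pr[X > x] dx ≤ r·(1 + ln t). Consequently, if Pr[X ≤ t·r] > 0, then E[X ∣ X ≤ t·r] ≤ r·(1 + ln t). -/
open MeasureTheory ProbabilityTheory ENNReal

/-- An antitone function bounded by `1` and by `r / x` has integral at most `r * (1 + log t)`
over `[0, t * r]`. -/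
theorem intervalIntegral_le_of_antitone_of_mul_le {G : ℝ → ℝ} (hG : Antitone G)
    (hG_one : ∀ x, G x ≤ 1) {r t : ℝ} (hr : 0 < r) (hrev : ∀ p > 0, p * G p ≤ r) (ht : 1 ≤ t) :
    ∫ x in (0 : ℝ)..(t * r), G x ≤ r * (1 + Real.log t) := by
  have hrt : r ≤ t * r := le_mul_of_one_le_left hr.le ht
  have hint (a b : ℝ) : IntervalIntegrable G volume a b := hG.intervalIntegrable
  have hle : ∫ x in (0 : ℝ)..r, G x ≤ r := by
    simpa using intervalIntegral.integral_mono_on hr.le (hint 0 r)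
      (intervalIntegrable_const (c := (1 : ℝ))) fun x _ ↦ hG_one x
  have hnot : (0 : ℝ) ∉ Set.uIcc r (t * r) := by
    rw [Set.uIcc_of_le hrt]
    exact fun h ↦ hr.not_ge h.1
  have hge : ∫ x in r..(t * r), G x ≤ r * Real.log t := by
    have hinv : IntervalIntegrable (fun x : ℝ ↦ r * x⁻¹) volume r (t * r) :=
      (intervalIntegrable_inv_iff.2 (Or.inr hnot)).const_mul r
    have h := intervalIntegral.integral_mono_on hrt (hint r (t * r)) hinv fun x hx ↦ by
      have hx0 : 0 < x := hr.trans_le hx.1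
      rw [← div_eq_mul_inv, le_div_iff₀ hx0, mul_comm]
      exact hrev x hx0
    rwa [intervalIntegral.integral_const_mul, integral_inv hnot,
      mul_div_cancel_right₀ t hr.ne'] at h
  rw [← intervalIntegral.integral_add_adjacent_intervals (hint 0 r) (hint r (t * r))]
  linarith

/-- Conditioning on an upper bound does not increase the upper tails of a random variable. -/
theorem cond_real_le_setOf_le {Ω : Type*} [MeasurableSpace Ω] (μ : Measure Ω)
    [IsProbabilityMeasure μ] {X : Ω → ℝ} (hX : Measurable X) {T : ℝ}
    (hT : 0 < μ {ω | X ω ≤ T}) (p : ℝ) :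
    (μ[|{ω | X ω ≤ T}]).real {ω | p ≤ X ω} ≤ μ.real {ω | p ≤ X ω} := by
  have hS : MeasurableSet {ω | X ω ≤ T} := measurableSet_le hX measurable_const
  have hpos : 0 < μ.real {ω | X ω ≤ T} := ENNReal.toReal_pos hT.ne' (measure_ne_top _ _)
  rw [measureReal_def, cond_apply hS, ENNReal.toReal_mul, ENNReal.toReal_inv, ← measureReal_def,
    ← measureReal_def, inv_mul_le_iff₀ hpos]
  rcases lt_or_ge T p with hp | hp
  · have hempty : {ω | X ω ≤ T} ∩ {ω | p ≤ X ω} = ∅ := by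
      ext ω
      simpa using fun h ↦ h.trans_lt hp
    rw [hempty, measureReal_empty]
    positivity
  · have huniv : {ω | X ω ≤ T} ∪ {ω | p ≤ X ω} = Set.univ := by
      ext ω
      simpa using (le_total (X ω) T).imp_right hp.trans
    have hadd := measureReal_union_add_inter' (μ := μ) (t := {ω | p ≤ X ω}) hS
    rw [huniv, probReal_univ] at hadd
    nlinarith [measureReal_le_one (μ := μ) (s := {ω | X ω ≤ T}),
      measureReal_le_one (μ := μ) (s := {ω | p ≤ X ω})]

/-- If the monopoly revenue of a nonnegative value `X` is at most `r` and `t ≥ 1`,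
then `∫_0^{t·r} Pr[X > x] dx ≤ r·(1 + ln t)`; consequently the core welfare
`E[X ∣ X ≤ t·r]` is at most `r·(1 + ln t)`. -/
theorem core_welfare_single_le {Ω : Type*} [MeasurableSpace Ω]
    (μ : Measure Ω) [IsProbabilityMeasure μ]
    (X : Ω → ℝ) (hX : Measurable X) (hnn : ∀ ω, 0 ≤ X ω)
    (r : ℝ) (hr : 0 < r) (hrev : ∀ p > (0:ℝ), p * (μ {ω | p ≤ X ω}).toReal ≤ r)
    (t : ℝ) (ht : 1 ≤ t) :
    (∫ x in (0:ℝ)..(t * r), (μ {ω | x < X ω}).toReal) ≤ r * (1 + Real.log t) ∧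
    (0 < μ {ω | X ω ≤ t * r} →
      (∫ ω, X ω ∂(μ[|{ω | X ω ≤ t * r}])) ≤ r * (1 + Real.log t)) := by
  refine ⟨intervalIntegral_le_of_antitone_of_mul_le (G := fun x ↦ μ.real {ω | x < X ω})
    (fun x y hxy ↦ measureReal_mono fun ω hω ↦ hxy.trans_lt hω)
    (fun x ↦ measureReal_le_one) hr (fun p hp ↦ ?_) ht, fun hpos ↦ ?_⟩
  · refine (mul_le_mul_of_nonneg_left ?_ hp.le).trans (hrev p hp)
    exact measureReal_mono fun ω (hω : p < X ω) ↦ hω.le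
  · have hprob : IsProbabilityMeasure (μ[|{ω | X ω ≤ t * r}]) :=
      cond_isProbabilityMeasure hpos.ne'
    have hbound : ∀ᵐ ω ∂(μ[|{ω | X ω ≤ t * r}]), X ω ≤ t * r :=
      ae_cond_mem (measurableSet_le hX measurable_const)
    have hint : Integrable X (μ[|{ω | X ω ≤ t * r}]) :=
      .of_bound hX.aestronglyMeasurable (t * r) <| hbound.mono fun ω hω ↦ by
        rwa [Real.norm_of_nonneg (hnn ω)]
    rw [hint.integral_eq_integral_Ioc_meas_le (.of_forall hnn) hbound,
      ← intervalIntegral.integral_of_le (by positivity)]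
    refine intervalIntegral_le_of_antitone_of_mul_le
      (G := fun x ↦ (μ[|{ω | X ω ≤ t * r}]).real {ω | x ≤ X ω})
      (fun x y hxy ↦ measureReal_mono fun ω hω ↦ hxy.trans hω)
      (fun x ↦ measureReal_le_one) hr (fun p hp ↦ ?_) ht
    exact (mul_le_mul_of_nonneg_left (cond_real_le_setOf_le μ hX hpos p) hp.le).trans (hrev p hp)
end

section
/- Let v = (v_1, …, v_n) be a random vector of nonnegative real random variables with 0 < SRev(v) < ∞, and suppose the supremum defining BRev(v) is attained: there is a price p > 0 with q := Pr[∑_i v_i ≥ p] > 0 and BRev(v) = p·q. Then there exists a random vector v' = (v'_1, …, v'_n) of nonnegative real random variables such that ∑_{i=1}^n v'_i = p almost surely (a point-mass-in-sum distribution), 0 < SRev(v') < ∞, and BRev(v')·SRev(v) ≥ BRev(v)·SRev(v'); i.e., the ratio BRev/SRev does not decrease when passing to the point-mass-in-sum distribution v'. -/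
open MeasureTheory ProbabilityTheory ENNReal

theorem le_rev1 {Ω : Type*} [MeasurableSpace Ω] (μ : Measure Ω) (X : Ω → ℝ) {r : ℝ}
    (hr : 0 < r) : ENNReal.ofReal r * μ {ω | r ≤ X ω} ≤ rev1 μ X :=
  le_iSup₂ (f := fun (r : ℝ) (_ : 0 < r) => ENNReal.ofReal r * μ {ω | r ≤ X ω}) r hr

theorem rev1_map {Ω Ω' : Type*} [MeasurableSpace Ω] [MeasurableSpace Ω'] (μ : Measure Ω)
    {f : Ω → Ω'} (hf : Measurable f) {X : Ω' → ℝ} (hX : Measurable X) :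
    rev1 (μ.map f) X = rev1 μ (X ∘ f) := by
  unfold rev1
  congr! 4 with r hr
  rw [Measure.map_apply hf (measurableSet_le measurable_const hX)]
  rfl

/-- Conditioning on an event on which `Y ≤ X` costs at most the inverse probability. -/
theorem rev1_cond_le {Ω : Type*} [MeasurableSpace Ω] (μ : Measure Ω) {E : Set Ω}
    (hE : MeasurableSet E) {X Y : Ω → ℝ} (hYX : ∀ ω ∈ E, Y ω ≤ X ω) :
    rev1 (μ[|E]) Y ≤ (μ E)⁻¹ * rev1 μ X := by
  refine iSup₂_le fun r hr => ?_
  rw [cond_apply hE, mul_left_comm]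
  gcongr
  refine le_trans ?_ (le_rev1 μ X hr)
  gcongr
  rintro ω ⟨hω, hr'⟩
  exact le_trans hr' (hYX ω hω)

theorem srev_pos_of_sum_eq {Ω : Type*} [MeasurableSpace Ω] (μ : Measure Ω)
    [IsProbabilityMeasure μ] {n : ℕ} (v : Fin n → Ω → ℝ) {p : ℝ} (hp : 0 < p)
    (hsum : ∀ᵐ ω ∂μ, ∑ i, v i ω = p) : 0 < srev μ v := by
  obtain ⟨ω₀, hω₀⟩ := hsum.exists
  have hn : 0 < n := by
    rcases Nat.eq_zero_or_pos n with rfl | h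
    · simp only [Finset.univ_eq_empty, Finset.sum_empty] at hω₀
      exact absurd hω₀ hp.ne
    · exact h
  have hpn : 0 < p / n := by positivity
  rw [pos_iff_ne_zero]
  intro h0
  have hlt : ∀ᵐ ω ∂μ, ∀ i, v i ω < p / n := by
    refine ae_all_iff.2 fun i => ?_
    have hi : rev1 μ (v i) = 0 := Finset.sum_eq_zero_iff.1 h0 i (Finset.mem_univ i)
    have hle := le_rev1 μ (v i) hpn
    rw [hi, nonpos_iff_eq_zero, mul_eq_zero] at hle
    simpa [ae_iff] using hle.resolve_left (by simpa using hpn)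
  obtain ⟨ω, hω, hωp⟩ := (hlt.and hsum).exists
  have : NeZero n := ⟨hn.ne'⟩
  have hsumlt : ∑ i, v i ω < ∑ _i : Fin n, p / n :=
    Finset.sum_lt_sum_of_nonempty Finset.univ_nonempty fun i _ => hω i
  rw [hωp, Finset.sum_const, Finset.card_univ, Fintype.card_fin, nsmul_eq_mul,
    mul_div_cancel₀ p (by positivity)] at hsumlt
  exact lt_irrefl p hsumlt

/-- If `0 < SRev(v) < ∞` and the supremum defining `BRev(v)` is attained at a
price `p > 0` that sells with probability `q > 0` (so `BRev(v) = p·q`), then there is a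
nonnegative random vector `v'` with `∑ᵢ v'ᵢ = p` almost surely (point-mass-in-sum),
`0 < SRev(v') < ∞`, and `BRev(v')/SRev(v') ≥ BRev(v)/SRev(v)` (stated by cross-multiplying). -/
theorem exists_point_mass_in_sum_nondecreasing_ratio {n : ℕ}
    {Ω : Type*} [MeasurableSpace Ω] (μ : Measure Ω) [IsProbabilityMeasure μ]
    (v : Fin n → Ω → ℝ) (hmeas : ∀ i, Measurable (v i)) (hnn : ∀ i ω, 0 ≤ v i ω)
    (hspos : 0 < srev μ v) (hsfin : srev μ v < ⊤)
    (p : ℝ) (hp : 0 < p)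
    (hq : μ {ω | p ≤ ∑ i, v i ω} ≠ 0)
    (hatt : brev μ v = ENNReal.ofReal p * μ {ω | p ≤ ∑ i, v i ω}) :
    ∃ (Ω' : Type) (_ : MeasurableSpace Ω') (μ' : Measure Ω') (_ : IsProbabilityMeasure μ')
      (v' : Fin n → Ω' → ℝ),
      (∀ i, Measurable (v' i)) ∧ (∀ i ω, 0 ≤ v' i ω) ∧
      (∀ᵐ ω ∂μ', ∑ i, v' i ω = p) ∧
      0 < srev μ' v' ∧ srev μ' v' < ⊤ ∧
      brev μ v * srev μ' v' ≤ brev μ' v' * srev μ v := by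
  set S : Ω → ℝ := fun ω => ∑ i, v i ω
  have hSm : Measurable S := Finset.measurable_sum _ fun i _ => hmeas i
  set E : Set Ω := {ω | p ≤ S ω}
  have hE : MeasurableSet E := measurableSet_le measurable_const hSm
  have : IsProbabilityMeasure (μ[|E]) := cond_isProbabilityMeasure hq
  let w : Ω → Fin n → ℝ := fun ω i => p / S ω * v i ω
  have hw : Measurable w :=
    measurable_pi_lambda _ fun i => (measurable_const.div hSm).mul (hmeas i)
  let v' : Fin n → (Fin n → ℝ) → ℝ := fun i x => |x i|
  have hv' : ∀ i, Measurable (v' i) := fun i => (measurable_pi_apply i).abs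
  let ν : Measure (Fin n → ℝ) := (μ[|E]).map w
  have hν : IsProbabilityMeasure ν := Measure.isProbabilityMeasure_map hw.aemeasurable
  have hwnn : ∀ ω ∈ E, ∀ i, v' i (w ω) = p / S ω * v i ω := fun ω hω i =>
    abs_of_nonneg (mul_nonneg (div_nonneg hp.le (hp.le.trans hω)) (hnn i ω))
  have hsum : ∀ᵐ x ∂ν, ∑ i, v' i x = p := by
    have hsm : MeasurableSet {x | ∑ i, v' i x = p} :=
      (Finset.measurable_sum _ fun i _ => hv' i) (measurableSet_singleton p)
    refine (ae_map_iff hw.aemeasurable hsm).2 ?_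
    filter_upwards [ae_cond_mem hE] with ω hω
    have hSω : S ω ≠ 0 := (hp.trans_le hω).ne'
    rw [Finset.sum_congr rfl fun i _ => hwnn ω hω i, ← Finset.mul_sum]
    exact div_mul_cancel₀ p hSω
  have hsrev : srev ν v' ≤ (μ E)⁻¹ * srev μ v := by
    unfold srev
    rw [Finset.mul_sum]
    refine Finset.sum_le_sum fun i _ => ?_
    rw [rev1_map _ hw (hv' i)]
    refine rev1_cond_le μ hE fun ω hω => ?_
    rw [Function.comp_apply, hwnn ω hω i]
    exact mul_le_of_le_one_left (hnn i ω) (div_le_one_of_le₀ hω (hp.le.trans hω))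
  have hbrev : ENNReal.ofReal p ≤ brev ν v' := by
    have h1 : ν {x | p ≤ ∑ i, v' i x} = 1 :=
      (measure_congr (Filter.eventuallyEq_univ.2 (hsum.mono fun _ hx => hx.ge))).trans measure_univ
    have hle := le_rev1 ν (fun x => ∑ i, v' i x) hp
    rwa [h1, mul_one] at hle
  refine ⟨Fin n → ℝ, inferInstance, ν, hν, v', hv', fun i x => abs_nonneg _, hsum,
    srev_pos_of_sum_eq ν v' hp hsum,
    hsrev.trans_lt (ENNReal.mul_lt_top (ENNReal.inv_lt_top.2 (pos_iff_ne_zero.2 hq)) hsfin), ?_⟩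
  calc brev μ v * srev ν v'
      ≤ ENNReal.ofReal p * μ E * ((μ E)⁻¹ * srev μ v) := by
        rw [hatt]
        gcongr
    _ = ENNReal.ofReal p * srev μ v := by
        rw [mul_assoc, ← mul_assoc (μ E), ENNReal.mul_inv_cancel hq (measure_ne_top μ E), one_mul]
    _ ≤ brev ν v' * srev μ v := by gcongr
end

section
/- Let v = (v_1, …, v_n) be a random vector of nonnegative real random variables, and let v' = (v_{σ(1)}, …, v_{σ(n)}) be obtained by applying a uniformly random permutation σ of {1,…,n}, drawn independently of v, to the coordinates. Then: (i) all n one-dimensional marginals of v' are identical (v' is symmetric); (ii) BRev(v') = BRev(v); (iii) SRev(v') ≤ SRev(v); and (iv) if ∑_i v_i = p almost surely for a constant p, then ∑_i v'_i = p almost surely as well. In particular, there exists a symmetric random vector whose ratio BRev/SRev is at least that of v, and which is point-mass-in-sum whenever v is. -/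
open MeasureTheory ProbabilityTheory ENNReal

/-- Permutations form a finite set; we equip them with the discrete σ-algebra. -/
instance (n : ℕ) : MeasurableSpace (Equiv.Perm (Fin n)) := ⊤

/-- Slicing the law of `ω` paired with an independent uniformly random permutation along the
permutation. -/
lemma prod_uniformPerm_apply {n : ℕ} {Ω : Type*} [MeasurableSpace Ω] (μ : Measure Ω) [SFinite μ]
    {s : Set (Ω × Equiv.Perm (Fin n))} (hs : MeasurableSet s) :
    μ.prod (PMF.uniformOfFintype (Equiv.Perm (Fin n))).toMeasure s =
      ∑ σ, (Fintype.card (Equiv.Perm (Fin n)) : ℝ≥0∞)⁻¹ * μ ((fun ω => (ω, σ)) ⁻¹' s) := by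
  rw [Measure.prod_apply_symm hs, lintegral_fintype]
  refine Finset.sum_congr rfl fun σ _ => ?_
  rw [PMF.toMeasure_apply_singleton _ _ (measurableSet_singleton σ), PMF.uniformOfFintype_apply,
    mul_comm]

/-- The coordinate of a random vector selected by a random permutation is measurable. -/
lemma measurable_permuted_coordinate {n : ℕ} {Ω : Type*} [MeasurableSpace Ω]
    {v : Fin n → Ω → ℝ} (hmeas : ∀ i, Measurable (v i)) (i : Fin n) :
    Measurable fun x : Ω × Equiv.Perm (Fin n) => v (x.2 i) x.1 :=
  measurable_from_prod_countable_left fun σ => hmeas (σ i)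

/-- The monopoly revenue of a randomly permuted coordinate is at most the average of the monopoly
revenues over all permutations. -/
lemma rev1_permuted_coordinate_le {n : ℕ} {Ω : Type*} [MeasurableSpace Ω] (μ : Measure Ω)
    [SFinite μ] {v : Fin n → Ω → ℝ} (hmeas : ∀ i, Measurable (v i)) (i : Fin n) :
    rev1 (μ.prod (PMF.uniformOfFintype (Equiv.Perm (Fin n))).toMeasure)
        (fun x => v (x.2 i) x.1) ≤
      ∑ σ : Equiv.Perm (Fin n),
        (Fintype.card (Equiv.Perm (Fin n)) : ℝ≥0∞)⁻¹ * rev1 μ (v (σ i)) := by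
  refine iSup₂_le fun p hp => ?_
  rw [prod_uniformPerm_apply μ
    (measurableSet_le measurable_const (measurable_permuted_coordinate hmeas i)), Finset.mul_sum]
  refine Finset.sum_le_sum fun σ _ => ?_
  rw [mul_left_comm]
  gcongr
  exact le_iSup₂ (f := fun (p : ℝ) (_ : 0 < p) => ENNReal.ofReal p * μ {ω | p ≤ v (σ i) ω}) p hp

/-- Monopoly revenue is invariant under adjoining independent randomness. -/
lemma rev1_prod_fst {Ω Ω' : Type*} [MeasurableSpace Ω] [MeasurableSpace Ω'] (μ : Measure Ω)
    (ν : Measure Ω') [SFinite μ] [IsProbabilityMeasure ν] {X : Ω → ℝ} (hX : Measurable X) :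
    rev1 (μ.prod ν) (fun x => X x.1) = rev1 μ X := by
  unfold rev1
  congr! 4 with p hp
  exact (measurePreserving_fst (μ := μ) (ν := ν)).measure_preimage
    (measurableSet_le measurable_const hX).nullMeasurableSet

/-- Applying a uniformly random permutation (independent of `v`) to the
coordinates of `v` yields a random vector `v'` that (i) is symmetric (all marginals equal),
(ii) has the same bundle revenue, (iii) has no larger separate-sale revenue, and (iv) is
point-mass-in-sum whenever `v` is. -/
theorem random_permutation_symmetrization {n : ℕ}
    {Ω : Type*} [MeasurableSpace Ω] (μ : Measure Ω) [IsProbabilityMeasure μ]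
    (v : Fin n → Ω → ℝ) (hmeas : ∀ i, Measurable (v i)) (hnn : ∀ i ω, 0 ≤ v i ω) :
    let ν : Measure (Equiv.Perm (Fin n)) := (PMF.uniformOfFintype (Equiv.Perm (Fin n))).toMeasure
    let μ' : Measure (Ω × Equiv.Perm (Fin n)) := μ.prod ν
    let v' : Fin n → Ω × Equiv.Perm (Fin n) → ℝ := fun i x => v (x.2 i) x.1
    (∀ i j, Measure.map (v' i) μ' = Measure.map (v' j) μ') ∧
    brev μ' v' = brev μ v ∧
    srev μ' v' ≤ srev μ v ∧
    ∀ p : ℝ, (∀ᵐ ω ∂μ, ∑ i, v i ω = p) → (∀ᵐ x ∂μ', ∑ i, v' i x = p) := by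
  intro ν μ' v'
  have hsum : ∀ x, ∑ i, v' i x = ∑ i, v i x.1 := fun x => Equiv.sum_comp x.2 fun i => v i x.1
  have hv' : ∀ i, Measurable (v' i) := measurable_permuted_coordinate hmeas
  refine ⟨fun i j => ?_, ?_, ?_, fun p hp => ?_⟩
  · ext s hs
    rw [Measure.map_apply (hv' i) hs, Measure.map_apply (hv' j) hs,
      prod_uniformPerm_apply μ (hv' i hs), prod_uniformPerm_apply μ (hv' j hs)]
    refine Fintype.sum_equiv (Equiv.mulRight (Equiv.swap i j)) _ _ fun σ => ?_
    congr 2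
    ext ω
    simp [v']
  · unfold brev
    simp_rw [hsum]
    exact rev1_prod_fst μ ν (X := fun ω => ∑ i, v i ω)
      (Finset.measurable_sum _ fun i _ => hmeas i)
  · calc srev μ' v'
        ≤ ∑ i, ∑ σ : Equiv.Perm (Fin n),
            (Fintype.card (Equiv.Perm (Fin n)) : ℝ≥0∞)⁻¹ * rev1 μ (v (σ i)) :=
          Finset.sum_le_sum fun i _ => rev1_permuted_coordinate_le μ hmeas i
      _ = ∑ σ : Equiv.Perm (Fin n), (Fintype.card (Equiv.Perm (Fin n)) : ℝ≥0∞)⁻¹ * srev μ v := by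
          rw [Finset.sum_comm]
          refine Finset.sum_congr rfl fun σ _ => ?_
          rw [← Finset.mul_sum, Equiv.sum_comp σ fun i => rev1 μ (v i), srev]
      _ = srev μ v := by
          rw [Finset.sum_const, Finset.card_univ, nsmul_eq_mul, ← mul_assoc,
            ENNReal.mul_inv_cancel (by simp [Fintype.card_ne_zero]) (ENNReal.natCast_ne_top _),
            one_mul]
  · simp_rw [hsum]
    exact Measure.quasiMeasurePreserving_fst.ae hp
end

section
/- Let n ≥ 2 be an integer and let v = (v_1, …, v_n) be a random vector of nonnegative real random variables whose n one-dimensional marginals are all identical (symmetric) and such that ∑_{i=1}^n v_i = p almost surely for some constant p > 0. Then BRev(v) ≤ 5·ln(n)·SRev(v); equivalently, p ≤ 5·ln(n)·SRev(v). -/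
open MeasureTheory ProbabilityTheory ENNReal

theorem ofReal_mul_measure_le_rev1 {Ω : Type*} [MeasurableSpace Ω] (μ : Measure Ω) (X : Ω → ℝ)
    {t : ℝ} (ht : 0 < t) : ENNReal.ofReal t * μ {ω | t ≤ X ω} ≤ rev1 μ X :=
  le_iSup₂ (f := fun (q : ℝ) (_ : 0 < q) => ENNReal.ofReal q * μ {ω | q ≤ X ω}) t ht

/-- Monopoly revenue is at most any almost sure upper bound on the value. -/
theorem rev1_le_ofReal {Ω : Type*} [MeasurableSpace Ω] (μ : Measure Ω) [IsProbabilityMeasure μ]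
    {X : Ω → ℝ} {b : ℝ} (hb : ∀ᵐ ω ∂μ, X ω ≤ b) : rev1 μ X ≤ ENNReal.ofReal b := by
  refine iSup₂_le fun q _ => ?_
  rcases le_or_gt q b with hqb | hqb
  · calc ENNReal.ofReal q * μ {ω | q ≤ X ω} ≤ ENNReal.ofReal q * 1 := by
          gcongr
          exact prob_le_one
      _ ≤ ENNReal.ofReal b := by
          rw [mul_one]
          exact ENNReal.ofReal_le_ofReal hqb
  · have h0 : μ {ω | q ≤ X ω} = 0 := measure_eq_zero_iff_ae_notMem.2 <|
      hb.mono fun ω hω h => absurd (le_trans h hω) (not_le.2 hqb)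
    simp [h0]

theorem lintegral_Ioc_ofReal_inv {a b : ℝ} (ha : 0 < a) (hab : a ≤ b) :
    ∫⁻ t in Set.Ioc a b, ENNReal.ofReal t⁻¹ = ENNReal.ofReal (Real.log (b / a)) := by
  have hint : IntervalIntegrable (fun t : ℝ => t⁻¹) volume a b :=
    intervalIntegrable_inv_iff.2 <| Or.inr fun h => by
      rw [Set.uIcc_of_le hab] at h
      exact absurd h.1 (not_le.2 ha)
  rw [← integral_inv_of_pos ha (ha.trans_le hab), intervalIntegral.integral_of_le hab,
    ofReal_integral_eq_lintegral_ofReal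
      ((intervalIntegrable_iff_integrableOn_Ioc_of_le hab).1 hint)]
  exact (ae_restrict_iff' measurableSet_Ioc).2 <| .of_forall fun t ht =>
    inv_nonneg.2 (ha.trans ht.1).le

/-- The expectation of a value bounded by `b` exceeds `a` by at most `log (b / a)` times the
monopoly revenue. -/
theorem lintegral_ofReal_le_add_log_mul_rev1 {Ω : Type*} [MeasurableSpace Ω] (μ : Measure Ω)
    [IsProbabilityMeasure μ] {X : Ω → ℝ} (hX : Measurable X) (hnn : ∀ ω, 0 ≤ X ω) {a b : ℝ}
    (ha : 0 < a) (hab : a ≤ b) (hb : ∀ᵐ ω ∂μ, X ω ≤ b) :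
    ∫⁻ ω, ENNReal.ofReal (X ω) ∂μ
      ≤ ENNReal.ofReal a + ENNReal.ofReal (Real.log (b / a)) * rev1 μ X := by
  have htail : ∫⁻ t in Set.Ioi b, μ {ω | t ≤ X ω} = 0 := by
    refine (setLIntegral_congr_fun measurableSet_Ioi (g := fun _ => 0) fun t ht => ?_).trans
      lintegral_zero
    exact measure_eq_zero_iff_ae_notMem.2 <|
      hb.mono fun ω hω h => absurd (le_trans h hω) (not_le.2 ht)
  have hlow : ∫⁻ t in Set.Ioc 0 a, μ {ω | t ≤ X ω} ≤ ENNReal.ofReal a := by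
    calc ∫⁻ t in Set.Ioc 0 a, μ {ω | t ≤ X ω} ≤ ∫⁻ _ in Set.Ioc 0 a, 1 :=
          lintegral_mono fun _ => prob_le_one
      _ = ENNReal.ofReal a := by simp
  have hmid : ∫⁻ t in Set.Ioc a b, μ {ω | t ≤ X ω}
      ≤ ENNReal.ofReal (Real.log (b / a)) * rev1 μ X := by
    rw [← lintegral_Ioc_ofReal_inv ha hab, ← lintegral_mul_const _ (by fun_prop)]
    refine setLIntegral_mono' measurableSet_Ioc fun t ht => ?_
    have ht0 : 0 < t := ha.trans ht.1
    calc μ {ω | t ≤ X ω} = ENNReal.ofReal t⁻¹ * (ENNReal.ofReal t * μ {ω | t ≤ X ω}) := by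
          rw [← mul_assoc, ← ENNReal.ofReal_mul (inv_nonneg.2 ht0.le), inv_mul_cancel₀ ht0.ne']
          simp
      _ ≤ ENNReal.ofReal t⁻¹ * rev1 μ X := by
          gcongr
          exact ofReal_mul_measure_le_rev1 μ X ht0
  rw [lintegral_eq_lintegral_meas_le μ (.of_forall hnn) hX.aemeasurable,
    ← Set.Ioc_union_Ioi_eq_Ioi (ha.le.trans hab), ← Set.Ioc_union_Ioc_eq_Ioc ha.le hab]
  calc _ ≤ _ := lintegral_union_le _ _ _
    _ ≤ _ := add_le_add_left (lintegral_union_le _ _ _) _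
    _ ≤ _ := by
      rw [htail, add_zero]
      exact add_le_add hlow hmid

/-- For `n ≥ 2` and a symmetric point-mass-in-sum nonnegative random vector
(`∑ᵢ vᵢ = p > 0` almost surely, all marginals equal), `BRev(v) ≤ 5·ln(n)·SRev(v)`;
equivalently, `p ≤ 5·ln(n)·SRev(v)`. -/
theorem symmetric_point_mass_brev_le {n : ℕ} (hn : 2 ≤ n)
    {Ω : Type*} [MeasurableSpace Ω] (μ : Measure Ω) [IsProbabilityMeasure μ]
    (v : Fin n → Ω → ℝ) (hmeas : ∀ i, Measurable (v i)) (hnn : ∀ i ω, 0 ≤ v i ω)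
    (hsym : ∀ i j, Measure.map (v i) μ = Measure.map (v j) μ)
    (p : ℝ) (hp : 0 < p) (hsum : ∀ᵐ ω ∂μ, ∑ i, v i ω = p) :
    brev μ v ≤ ENNReal.ofReal (5 * Real.log n) * srev μ v ∧
    ENNReal.ofReal p ≤ ENNReal.ofReal (5 * Real.log n) * srev μ v := by
  have hn2 : (2 : ℝ) ≤ n := by exact_mod_cast hn
  have hn0 : (0 : ℝ) < n := by linarith
  have hle : ∀ i, ∀ᵐ ω ∂μ, v i ω ≤ p := fun i => by
    filter_upwards [hsum] with ω hω
    rw [← hω]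
    exact Finset.single_le_sum (f := fun j => v j ω) (fun j _ => hnn j ω) (Finset.mem_univ i)
  have hmean : ENNReal.ofReal p = ∑ i, ∫⁻ ω, ENNReal.ofReal (v i ω) ∂μ := by
    rw [← lintegral_finsetSum _ fun i _ => (hmeas i).ennreal_ofReal]
    calc ENNReal.ofReal p = ∫⁻ _, ENNReal.ofReal p ∂μ := by simp
      _ = _ := lintegral_congr_ae <| by
        filter_upwards [hsum] with ω hω
        rw [← hω, ENNReal.ofReal_sum_of_nonneg fun i _ => hnn i ω]
  have ha : 0 < p / (2 * n) := by positivity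
  have hab : p / (2 * n) ≤ p := div_le_self hp.le (by linarith)
  have hbound : ENNReal.ofReal p
      ≤ ENNReal.ofReal (p / 2) + ENNReal.ofReal (Real.log (2 * n)) * srev μ v := by
    calc ENNReal.ofReal p
        ≤ ∑ i, (ENNReal.ofReal (p / (2 * n))
            + ENNReal.ofReal (Real.log (p / (p / (2 * n)))) * rev1 μ (v i)) := by
          rw [hmean]
          exact Finset.sum_le_sum fun i _ =>
            lintegral_ofReal_le_add_log_mul_rev1 μ (hmeas i) (hnn i) ha hab (hle i)
      _ = _ := by
          rw [Finset.sum_add_distrib, ← Finset.mul_sum, div_div_cancel₀ hp.ne', srev]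
          congr 1
          rw [← ENNReal.ofReal_sum_of_nonneg fun _ _ => ha.le]
          congr 1
          simp only [Finset.sum_const, Finset.card_univ, Fintype.card_fin, nsmul_eq_mul]
          field_simp
  have hhalf : ENNReal.ofReal (p / 2) ≤ ENNReal.ofReal (Real.log (2 * n)) * srev μ v := by
    refine ENNReal.le_of_add_le_add_left (a := ENNReal.ofReal (p / 2)) ENNReal.ofReal_ne_top ?_
    rwa [← ENNReal.ofReal_add (by positivity) (by positivity), add_halves]
  have hlog : 2 * Real.log (2 * n) ≤ 5 * Real.log n := by
    have hlog2 : Real.log 2 ≤ Real.log n := Real.log_le_log two_pos hn2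
    have hlog0 : 0 < Real.log 2 := Real.log_pos one_lt_two
    rw [Real.log_mul two_ne_zero hn0.ne']
    linarith
  have hmain : ENNReal.ofReal p ≤ ENNReal.ofReal (5 * Real.log n) * srev μ v := by
    calc ENNReal.ofReal p = ENNReal.ofReal 2 * ENNReal.ofReal (p / 2) := by
          rw [← ENNReal.ofReal_mul zero_le_two, mul_div_cancel₀ p two_ne_zero]
      _ ≤ ENNReal.ofReal 2 * (ENNReal.ofReal (Real.log (2 * n)) * srev μ v) := by gcongr
      _ = ENNReal.ofReal (2 * Real.log (2 * n)) * srev μ v := by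
          rw [← mul_assoc, ← ENNReal.ofReal_mul zero_le_two]
      _ ≤ _ := by gcongr
  exact ⟨(rev1_le_ofReal μ (hsum.mono fun _ h => h.le)).trans hmain, hmain⟩
end

section
/- For every real number n ≥ 2 and every real number p > 0, if p ≤ n + n·ln(p) then p ≤ 5·n·ln(n). -/
/-- For real `n ≥ 2` and `p > 0`, if `p ≤ n + n·ln p` then `p ≤ 5·n·ln n`. -/
theorem le_five_n_log_n (n p : ℝ) (hn : 2 ≤ n) (hp : 0 < p)
    (h : p ≤ n + n * Real.log p) : p ≤ 5 * n * Real.log n := by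
  have hn0 : 0 < n := by linarith
  have htangent : Real.log (p / (2 * n)) ≤ p / (2 * n) - 1 :=
    Real.log_le_sub_one_of_pos (by positivity)
  rw [Real.log_div hp.ne' (by positivity), Real.log_mul two_ne_zero hn0.ne'] at htangent
  have hlog : Real.log 2 ≤ Real.log n := Real.log_le_log two_pos hn
  have hlog0 : 0 ≤ Real.log n := Real.log_nonneg (by linarith)
  have hlogp : Real.log p ≤ 2 * Real.log n + p / (2 * n) - 1 := by linarith
  have hmul := mul_le_mul_of_nonneg_left hlogp hn0.le
  have hcancel : n * (p / (2 * n)) = p / 2 := by field_simp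
  have hnonneg : 0 ≤ n * Real.log n := mul_nonneg hn0.le hlog0
  linarith
end

section
/- For every integer n ≥ 2 and all real numbers c ≥ 1 and a ≥ 1, ∑_{j=2}^{n} a·j·C(n−1, j−1)·(c·a·n)^{−(j−1)} ≤ (2/c)·e^{1/(c·a)}, where C(n−1, j−1) denotes the binomial coefficient. -/
open Nat in
/-- The summand with index `j = i + 2` is at most `2/c` times the `i`-th term of the Taylor
series of `e^{1/(c·a)}`. -/
theorem tail_binomial_term_le {n : ℕ} (hn : n ≠ 0) {c a : ℝ} (hc : 0 < c) (ha : 0 < a) (i : ℕ) :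
    a * ((i + 2 : ℕ) : ℝ) * ((n - 1).choose (i + 1) : ℝ) / (c * a * n) ^ (i + 1)
      ≤ 2 / c * ((1 / (c * a)) ^ i / (i ! : ℝ)) := by
  have hn' : (0 : ℝ) < n := by positivity
  have hchoose : ((n - 1).choose (i + 1) : ℝ) ≤ (n : ℝ) ^ (i + 1) / ((i + 1)! : ℝ) :=
    (Nat.cast_le.2 (Nat.choose_le_choose _ (Nat.sub_le n 1))).trans (Nat.choose_le_pow_div _ _)
  have hj : ((i + 2 : ℕ) : ℝ) ≤ 2 * ((i : ℝ) + 1) := by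
    push_cast
    linarith [(Nat.cast_nonneg i : (0 : ℝ) ≤ i)]
  calc
    _ ≤ a * (2 * ((i : ℝ) + 1)) * ((n : ℝ) ^ (i + 1) / ((i + 1)! : ℝ)) / (c * a * n) ^ (i + 1) := by
      gcongr
    _ = _ := by
      rw [Nat.factorial_succ, one_div_pow, mul_pow (c * a), pow_succ (c * a)]
      push_cast
      field_simp

/-- For every integer `n ≥ 2` and reals `c ≥ 1`, `a ≥ 1`,
`∑_{j=2}^{n} a·j·C(n−1, j−1)/(c·a·n)^{j−1} ≤ (2/c)·e^{1/(c·a)}`. -/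
theorem tail_binomial_sum_le (n : ℕ) (hn : 2 ≤ n) (c a : ℝ) (hc : 1 ≤ c) (ha : 1 ≤ a) :
    ∑ j ∈ Finset.Icc 2 n,
      a * (j : ℝ) * ((n - 1).choose (j - 1) : ℝ) / (c * a * n) ^ (j - 1)
      ≤ 2 / c * Real.exp (1 / (c * a)) := by
  have hc' : 0 < c := by linarith
  have ha' : 0 < a := by linarith
  rw [← Finset.Ico_add_one_right_eq_Icc, Finset.sum_Ico_eq_sum_range]
  refine le_trans (Finset.sum_le_sum fun i _ => ?_) (?_ :
    ∑ i ∈ Finset.range (n + 1 - 2), 2 / c * ((1 / (c * a)) ^ i / (i.factorial : ℝ)) ≤ _)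
  · rw [add_comm 2 i]
    exact tail_binomial_term_le (by omega) hc' ha' i
  · rw [← Finset.mul_sum]
    gcongr
    exact Real.sum_le_exp_of_nonneg (by positivity) _
end
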